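/- Let $n\ge1$, $s\in(0,2)$, and either $p=1$ with $\beta\in(0,n)$, or $p\in(n/(n+\beta),1)$ with $\beta\in(0,1)$. Let $q_0\in[p,\infty)$ and let $\mu$ be a nonnegative Radon measure on $\mathbb{R}^{n+1}_+$. Then the following are equivalent, where $u(x,t)=(p_t^s*f)(x)$ denotes the Caffarelli–Silvestre extension of $f$: (i) there is a constant $C$ with $\big(\int_0^\infty \mu(\{(x,t):|u(x,t)|>\lambda\})^{p/q_0}\,d\lambda^p\big)^{1/p}\le C\|f\|_{\dot\Lambda^{p,p}_\beta}$ for all $f\in C_0^\infty(\mathbb{R}^n)$; (ii) there is a constant $C$ with $\big(\int_{\mathbb{R}^{n+1}_+}|u|^{q_0}d\mu\big)^{1/q_0}\le C\|f\|_{\dot\Lambda^{p,p}_\beta}$ for all $f\in C_0^\infty(\mathbb{R}^n)$; (iii) there is a constant $C$ with $\sup_{\lambda>0}\lambda\,\mu(\{(x,t):|u(x,t)|>\lambda\})^{1/q_0}\le C\|f\|_{\dot\Lambda^{p,p}_\beta}$ for all $f\in C_0^\infty(\mathbb{R}^n)$; (iv) $\sup_{x\in\mathbb{R}^n,\,r>0}\;\mu(T(B(x,r)))^{p/q_0}\,r^{p\beta-n}<\infty$.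 -/

import Mathlib

open MeasureTheory Real Set Metric
open scoped ENNReal

noncomputable section

/-- The normalizing constant `c(n,s) = Γ((n+s)/2)/(π^{n/2} Γ(s/2))`. -/
def cns (n : ℕ) (s : ℝ) : ℝ :=
  Real.Gamma (((n:ℝ) + s)/2) / (Real.pi ^ ((n:ℝ)/2) * Real.Gamma (s/2))

/-- The fractional Poisson kernel `p_t^s(x) = c(n,s) t^s (|x|² + t²)^{-(n+s)/2}`. -/
def pker (n : ℕ) (s t : ℝ) (x : EuclideanSpace ℝ (Fin n)) : ℝ :=
  cns n s * t ^ s * (‖x‖^2 + t^2) ^ (-((n:ℝ) + s)/2)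

/-- The Caffarelli–Silvestre extension `u(x,t) = (p_t^s * f)(x)`. -/
def csExt (n : ℕ) (s : ℝ) (f : EuclideanSpace ℝ (Fin n) → ℝ)
    (x : EuclideanSpace ℝ (Fin n)) (t : ℝ) : ℝ :=
  ∫ y, pker n s t (x - y) * f y

/-- The tent `T(O) = {(x,t) ∈ ℝ^{n+1}_+ : B(x,t) ⊆ O}` over a set `O ⊆ ℝⁿ`. -/
def tent (n : ℕ) (O : Set (EuclideanSpace ℝ (Fin n))) :
    Set (EuclideanSpace ℝ (Fin n) × ℝ) :=
  {z | 0 < z.2 ∧ Metric.ball z.1 z.2 ⊆ O}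

/-- Iterated difference `Δ_h^k f`, where `Δ_h^1 f(x) = f(x+h) - f(x)`. -/
def iterDiff (n : ℕ) (h : EuclideanSpace ℝ (Fin n)) (k : ℕ)
    (f : EuclideanSpace ℝ (Fin n) → ℝ) : EuclideanSpace ℝ (Fin n) → ℝ :=
  (fun (g : EuclideanSpace ℝ (Fin n) → ℝ) (x : EuclideanSpace ℝ (Fin n)) => g (x + h) - g x)^[k] f

/-- The homogeneous Besov quasinorm
`‖f‖_{Λ̇^{p,p}_β} = (∫_{ℝⁿ} ∫_{ℝⁿ} |Δ_h^k f(x)|^p dx |h|^{-(n+βp)} dh)^{1/p}`,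
with `k = 1 + ⌊β⌋`. -/
def besovNorm (n : ℕ) (β p : ℝ) (f : EuclideanSpace ℝ (Fin n) → ℝ) : ℝ :=
  (∫ h : EuclideanSpace ℝ (Fin n),
    (∫ x, |iterDiff n h (Nat.floor β + 1) f x| ^ p) * ‖h‖ ^ (-((n:ℝ) + β * p))) ^ (1/p)

/-- Condition (i): the Lorentz norm inequality
`‖u‖_{L^{q₀,p}_μ} ≲ ‖f‖_{Λ̇^{p,p}_β}`, i.e.
`(∫_0^∞ μ({|u| > λ})^{p/q₀} dλ^p)^{1/p} ≤ C ‖f‖_{Λ̇^{p,p}_β}` for all `f ∈ C_0^∞`. -/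
def condLorentz (n : ℕ) (s β p q₀ : ℝ)
    (μ : Measure (EuclideanSpace ℝ (Fin n) × ℝ)) : Prop :=
  ∃ C : ℝ, 0 < C ∧ ∀ f : EuclideanSpace ℝ (Fin n) → ℝ,
    ContDiff ℝ (⊤ : ℕ∞) f → HasCompactSupport f →
    (∫⁻ lam in Set.Ioi (0:ℝ),
        (μ {z | 0 < z.2 ∧ lam < |csExt n s f z.1 z.2|}) ^ (p/q₀)
          * ENNReal.ofReal (p * lam ^ (p-1)))
      ≤ ENNReal.ofReal (C * besovNorm n β p f) ^ p

/-- Condition (ii): the Lebesgue norm inequality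
`‖u‖_{L^{q₀}_μ} ≲ ‖f‖_{Λ̇^{p,p}_β}` for all `f ∈ C_0^∞`. -/
def condLebesgue (n : ℕ) (s β p q₀ : ℝ)
    (μ : Measure (EuclideanSpace ℝ (Fin n) × ℝ)) : Prop :=
  ∃ C : ℝ, 0 < C ∧ ∀ f : EuclideanSpace ℝ (Fin n) → ℝ,
    ContDiff ℝ (⊤ : ℕ∞) f → HasCompactSupport f →
    (∫⁻ z in {z : EuclideanSpace ℝ (Fin n) × ℝ | 0 < z.2},
        ENNReal.ofReal |csExt n s f z.1 z.2| ^ q₀ ∂μ)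
      ≤ ENNReal.ofReal (C * besovNorm n β p f) ^ q₀

/-- Condition (iii): the weak-type inequality
`sup_{λ>0} λ μ({|u| > λ})^{1/q₀} ≲ ‖f‖_{Λ̇^{p,p}_β}` for all `f ∈ C_0^∞`. -/
def condWeak (n : ℕ) (s β p q₀ : ℝ)
    (μ : Measure (EuclideanSpace ℝ (Fin n) × ℝ)) : Prop :=
  ∃ C : ℝ, 0 < C ∧ ∀ f : EuclideanSpace ℝ (Fin n) → ℝ,
    ContDiff ℝ (⊤ : ℕ∞) f → HasCompactSupport f →
    ∀ lam : ℝ, 0 < lam →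
      ENNReal.ofReal lam * (μ {z | 0 < z.2 ∧ lam < |csExt n s f z.1 z.2|}) ^ (1/q₀)
        ≤ ENNReal.ofReal (C * besovNorm n β p f)

/-- Condition (iv): the ball-tent condition
`sup_{x,r} μ(T(B(x,r)))^{p/q₀} r^{pβ-n} < ∞`. -/
def condBall (n : ℕ) (β p q₀ : ℝ)
    (μ : Measure (EuclideanSpace ℝ (Fin n) × ℝ)) : Prop :=
  ∃ C : ℝ, 0 < C ∧ ∀ (x : EuclideanSpace ℝ (Fin n)) (r : ℝ), 0 < r →
    (μ (tent n (Metric.ball x r))) ^ (p/q₀) ≤ ENNReal.ofReal (C * r ^ ((n:ℝ) - p*β))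

lemma two_rpow_ne_top (a : ℝ) : (2 : ℝ≥0∞) ^ a ≠ ∞ :=
  ENNReal.rpow_ne_top_of_ne_zero (by norm_num) (by norm_num)

lemma two_rpow_ne_zero (a : ℝ) : (2 : ℝ≥0∞) ^ a ≠ 0 := by
  simp [ENNReal.rpow_eq_zero_iff]

lemma two_rpow_add (a b : ℝ) : (2 : ℝ≥0∞) ^ (a + b) = 2 ^ a * 2 ^ b :=
  ENNReal.rpow_add _ _ (by norm_num) (by norm_num)

lemma ofReal_two_zpow (j : ℤ) : ENNReal.ofReal ((2 : ℝ) ^ j) = (2 : ℝ≥0∞) ^ (j : ℝ) := by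
  rw [← Real.rpow_intCast, ← ENNReal.ofReal_rpow_of_pos (by norm_num)]
  simp

lemma ennreal_rpow_anti {x y : ℝ≥0∞} (h : x ≤ y) {z : ℝ} (hz : z ≤ 0) : y ^ z ≤ x ^ z := by
  obtain ⟨w, rfl⟩ : ∃ w, z = -w := ⟨-z, by ring⟩
  rw [ENNReal.rpow_neg, ENNReal.rpow_neg, ENNReal.inv_le_inv]
  exact ENNReal.rpow_le_rpow h (by linarith)

/-- The geometric series `∑ 2 ^ (-γ m)` converges. -/
lemma tsum_two_rpow_neg_ne_top {γ : ℝ} (hγ : 0 < γ) :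
    ∑' m : ℕ, (2 : ℝ≥0∞) ^ (-γ * m) ≠ ∞ := by
  have h : ∀ m : ℕ, (2 : ℝ≥0∞) ^ (-γ * m) = ((2 : ℝ≥0∞) ^ (-γ)) ^ m := fun m => by
    rw [ENNReal.rpow_mul, ENNReal.rpow_natCast]
  simp_rw [h, ENNReal.tsum_geometric]
  refine ENNReal.inv_ne_top.2 (tsub_pos_of_lt ?_).ne'
  exact ENNReal.rpow_lt_one_of_one_lt_of_neg (by norm_num) (by linarith)

/-- Summing the decaying weights `2 ^ (-γ j)` over the scales `2 ^ j ≥ a`. -/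
lemma tsum_scales_ge_le {γ : ℝ} (hγ : 0 < γ) (a : ℝ≥0∞) :
    ∑' j : ℤ, (if a ≤ (2 : ℝ≥0∞) ^ (j : ℝ) then (2 : ℝ≥0∞) ^ (-γ * j) else 0)
      ≤ (∑' m : ℕ, (2 : ℝ≥0∞) ^ (-γ * m)) * a ^ (-γ) := by
  rcases eq_or_ne a 0 with rfl | h0
  · rw [ENNReal.zero_rpow_of_neg (by linarith), ENNReal.mul_top]
    · exact le_top
    · intro h
      have := ENNReal.tsum_eq_zero.1 h 0
      simp at this
  rcases eq_or_ne a ∞ with rfl | htop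
  · simp only [top_le_iff, two_rpow_ne_top, if_false, tsum_zero, zero_le]
  obtain ⟨i, hi1, hi2⟩ := ENNReal.exists_mem_Ioc_zpow h0 htop (y := 2) (by norm_num) (by norm_num)
  rw [← ENNReal.rpow_intCast] at hi1 hi2
  have hinj : Function.Injective (fun m : ℕ => i + 1 + (m : ℤ)) := fun x y h => by simpa using h
  rw [← hinj.tsum_eq, ← ENNReal.tsum_mul_right]
  · refine ENNReal.tsum_le_tsum fun m => ?_
    split_ifs
    · have : (-γ * ((i + 1 + (m : ℤ) : ℤ) : ℝ)) = -γ * m + ((i + 1 : ℤ) : ℝ) * (-γ) := by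
        push_cast; ring
      rw [this, two_rpow_add, ENNReal.rpow_mul 2 _ (-γ)]
      gcongr 2 ^ (-γ * m) * ?_
      exact ennreal_rpow_anti hi2 (by linarith)
    · exact zero_le
  · intro j hj
    simp only [Function.mem_support, ne_eq, ite_eq_right_iff, not_forall] at hj
    obtain ⟨hj, -⟩ := hj
    have h : i < j := by
      by_contra! hji
      exact absurd (hi1.trans_le hj) (not_lt.2 (ENNReal.rpow_le_rpow_of_exponent_le (by norm_num)
        (by exact_mod_cast hji)))
    exact ⟨(j - (i + 1)).toNat, by simp; omega⟩

/-- Summing the growing weights `2 ^ (γ j)` over the scales `2 ^ j ≤ a`. -/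
lemma tsum_scales_le_le {γ : ℝ} (hγ : 0 < γ) (a : ℝ≥0∞) :
    ∑' j : ℤ, (if (2 : ℝ≥0∞) ^ (j : ℝ) ≤ a then (2 : ℝ≥0∞) ^ (γ * j) else 0)
      ≤ (∑' m : ℕ, (2 : ℝ≥0∞) ^ (-γ * m)) * a ^ γ := by
  have h := tsum_scales_ge_le hγ a⁻¹
  rw [← (Equiv.neg ℤ).tsum_eq] at h
  refine le_of_eq_of_le (tsum_congr fun j => ?_) (h.trans_eq ?_)
  · simp only [Equiv.neg_apply, Int.cast_neg, ENNReal.rpow_neg 2 (j : ℝ), ENNReal.inv_le_inv,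
      neg_mul_neg]
  · rw [ENNReal.inv_rpow, ENNReal.rpow_neg, inv_inv]

/-- Countable subadditivity of `x ↦ x ^ p` for `0 < p ≤ 1`. -/
lemma tsum_rpow_le {ι : Type*} (f : ι → ℝ≥0∞) {p : ℝ} (hp : 0 < p) (hp1 : p ≤ 1) :
    (∑' i, f i) ^ p ≤ ∑' i, f i ^ p := by
  have hfin : ∀ t : Finset ι, (∑ i ∈ t, f i) ^ p ≤ ∑ i ∈ t, f i ^ p := fun t => by
    classical
    induction t using Finset.induction_on with
    | empty => simp [hp]
    | insert a t ha ih =>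
      rw [Finset.sum_insert ha, Finset.sum_insert ha]
      exact (ENNReal.rpow_add_le_add_rpow _ _ hp.le hp1).trans (by gcongr)
  have hlim : Filter.Tendsto (fun t : Finset ι => (∑ i ∈ t, f i) ^ p) Filter.atTop
      (nhds ((∑' i, f i) ^ p)) :=
    (ENNReal.continuous_rpow_const.tendsto _).comp ENNReal.summable.hasSum
  exact le_of_tendsto' hlim fun t => (hfin t).trans (ENNReal.sum_le_tsum t)

/-- Telescoping over all scales: a two-sided sequence running from `a` to `0`. -/
lemma ofReal_abs_le_tsum_of_tendsto {F : ℤ → ℝ} {a : ℝ}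
    (hbot : Filter.Tendsto (fun N : ℕ => F (-N)) Filter.atTop (nhds a))
    (htop : Filter.Tendsto (fun N : ℕ => F N) Filter.atTop (nhds 0)) :
    ENNReal.ofReal |a| ≤ ∑' j, ENNReal.ofReal |F j - F (j + 1)| := by
  have hlim : Filter.Tendsto (fun N : ℕ => ENNReal.ofReal |F (-N) - F N|) Filter.atTop
      (nhds (ENNReal.ofReal |a|)) := by
    have := (hbot.sub htop).abs
    rw [sub_zero] at this
    exact ENNReal.tendsto_ofReal this
  have hstep : ∀ (i : ℤ) (m : ℕ), |F i - F (i + m)|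
      ≤ ∑ l ∈ Finset.range m, |F (i + l) - F (i + l + 1)| := fun i m => by
    induction m with
    | zero => simp
    | succ m ih =>
      rw [Finset.sum_range_succ]
      have : F i - F (i + (m + 1 : ℕ)) = (F i - F (i + m)) + (F (i + m) - F (i + m + 1)) := by
        push_cast; rw [← add_assoc]; ring
      rw [this]
      exact (abs_add_le _ _).trans (by gcongr)
  refine le_of_tendsto' hlim fun N => ?_
  have h := hstep (-N) (2 * N)
  have e : (-(N : ℤ) + (2 * N : ℕ)) = N := by push_cast; ring
  rw [e] at h
  refine (ENNReal.ofReal_le_ofReal h).trans ?_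
  rw [ENNReal.ofReal_sum_of_nonneg fun _ _ => abs_nonneg _]
  refine (ENNReal.sum_le_tsum (f := fun l : ℕ =>
    ENNReal.ofReal |F (-(N : ℤ) + l) - F (-(N : ℤ) + l + 1)|) _).trans ?_
  exact ENNReal.tsum_comp_le_tsum_of_injective (f := fun l : ℕ => -(N : ℤ) + l)
    (fun x y hxy => by simpa using hxy) fun j => ENNReal.ofReal |F j - F (j + 1)|

/-- A linearizing measure for the set function `μ ^ θ` along the superlevel sets of `v`:
it is dominated by `μ ^ θ` on all measurable sets and dominates it on the superlevel sets. -/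
lemma exists_measure_rpow_equiv {X : Type*} [MeasurableSpace X] {θ : ℝ} (hθ : 0 < θ)
    (hθ1 : θ ≤ 1) :
    ∃ C : ℝ≥0∞, C ≠ ∞ ∧ ∀ (μ : Measure X) [SFinite μ] (v : X → ℝ), Measurable v →
      (∀ l : ℝ, 0 < l → μ {z | l < v z} ≠ ∞) →
      ∃ ν : Measure X, SFinite ν ∧ (∀ F, MeasurableSet F → ν F ≤ C * μ F ^ θ) ∧
        ∀ l : ℝ, 0 < l → μ {z | l < v z} ^ θ ≤ 2 * ν {z | l < v z} := by
  rcases hθ1.eq_or_lt with rfl | hθ1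
  · refine ⟨1, by simp, fun μ _ v _ _ => ⟨μ, inferInstance, by simp, fun l _ => ?_⟩⟩
    rw [ENNReal.rpow_one]
    exact le_mul_of_one_le_left' (by norm_num)
  refine ⟨(∑' m : ℕ, (2 : ℝ≥0∞) ^ (-(1 - θ) * m)) + ∑' m : ℕ, (2 : ℝ≥0∞) ^ (-θ * m),
    ENNReal.add_ne_top.2 ⟨tsum_two_rpow_neg_ne_top (by linarith), tsum_two_rpow_neg_ne_top hθ⟩,
    fun μ _ v hv hfin => ?_⟩
  let L : ℤ → Set ℚ := fun i => {q | μ {z | (q : ℝ) < v z} ≤ 2 ^ (i : ℝ)}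
  let A : ℤ → Set X := fun i => ⋃ q ∈ L i, {z | (q : ℝ) < v z}
  have hμA : ∀ i, μ (A i) ≤ 2 ^ (i : ℝ) := fun i => by
    rw [measure_biUnion_eq_iSup (Set.to_countable _)]
    · exact iSup₂_le fun q hq => hq
    · intro a ha b hb
      rcases le_total a b with h | h
      · exact ⟨a, ha, subset_rfl, fun z (hz : (b : ℝ) < v z) =>
          lt_of_le_of_lt (by exact_mod_cast h) hz⟩
      · exact ⟨b, hb, fun z (hz : (a : ℝ) < v z) =>
          lt_of_le_of_lt (by exact_mod_cast h) hz, subset_rfl⟩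
  have hsub : ∀ (i : ℤ) (l : ℝ), μ {z | l < v z} ≤ 2 ^ (i : ℝ) → {z | l < v z} ⊆ A i := by
    intro i l h z hz
    obtain ⟨q, hq1, hq2⟩ := exists_rat_btwn (show l < v z from hz)
    refine Set.mem_biUnion (x := q) ?_ hq2
    exact (measure_mono fun w (hw : (q : ℝ) < v w) => hq1.trans hw).trans h
  refine ⟨Measure.sum fun i : ℤ => (2 : ℝ≥0∞) ^ ((θ - 1) * i) • μ.restrict (A i),
    inferInstance, fun F hF => ?_, fun l hl => ?_⟩
  · rw [Measure.sum_apply _ hF]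
    have hterm : ∀ i : ℤ, ((2 : ℝ≥0∞) ^ ((θ - 1) * i) • μ.restrict (A i)) F ≤
        μ F * (if μ F ≤ (2 : ℝ≥0∞) ^ (i : ℝ) then (2 : ℝ≥0∞) ^ (-(1 - θ) * i) else 0)
        + (if (2 : ℝ≥0∞) ^ (i : ℝ) ≤ μ F then (2 : ℝ≥0∞) ^ (θ * i) else 0) := fun i => by
      rw [Measure.smul_apply, smul_eq_mul, Measure.restrict_apply hF]
      rcases le_total (μ F) ((2 : ℝ≥0∞) ^ (i : ℝ)) with h | h
      · rw [if_pos h, mul_comm, neg_sub]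
        refine le_trans ?_ le_self_add
        gcongr
        exact Set.inter_subset_left
      · rw [if_pos h]
        refine le_trans ?_ le_add_self
        have : θ * (i : ℝ) = (θ - 1) * i + i := by ring
        rw [this, two_rpow_add]
        gcongr
        exact (measure_mono Set.inter_subset_right).trans (hμA i)
    refine (ENNReal.tsum_le_tsum hterm).trans ?_
    rw [ENNReal.tsum_add, ENNReal.tsum_mul_left, add_mul]
    refine add_le_add ?_ (tsum_scales_le_le hθ _)
    rcases eq_or_ne (μ F) 0 with h0 | h0
    · simp [h0]
    rcases eq_or_ne (μ F) ∞ with ht | ht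
    · simp only [ht, top_le_iff, two_rpow_ne_top, if_false, tsum_zero, mul_zero, zero_le]
    refine (mul_le_mul_right (tsum_scales_ge_le (by linarith) _) _).trans_eq ?_
    have hpow : μ F ^ θ = μ F * μ F ^ (-(1 - θ)) := by
      conv_rhs => enter [1]; rw [← ENNReal.rpow_one (μ F)]
      rw [← ENNReal.rpow_add _ _ h0 ht]
      congr 1; ring
    rw [hpow]
    ring
  · have hE : MeasurableSet {z | l < v z} := measurableSet_lt measurable_const hv
    rcases eq_or_ne (μ {z | l < v z}) 0 with h0 | h0
    · simp [h0, hθ]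
    obtain ⟨i, hi1, hi2⟩ := ENNReal.exists_mem_Ioc_zpow h0 (hfin l hl) (y := 2)
      (by norm_num) (by norm_num)
    rw [← ENNReal.rpow_intCast] at hi1 hi2
    rw [Measure.sum_apply _ hE]
    refine le_trans ?_ (mul_le_mul_right (ENNReal.le_tsum (i + 1)) 2)
    rw [Measure.smul_apply, smul_eq_mul, Measure.restrict_apply hE,
      Set.inter_eq_left.2 (hsub _ _ hi2)]
    have hpow : μ {z | l < v z} ^ θ = μ {z | l < v z} ^ (θ - 1) * μ {z | l < v z} := by
      conv_rhs => rw [← ENNReal.rpow_one (μ {z | l < v z}), ← ENNReal.rpow_mul, one_mul,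
        ← ENNReal.rpow_add _ _ h0 (hfin l hl)]
      congr 1; ring
    rw [hpow, ← mul_assoc]
    gcongr
    calc _ ≤ ((2 : ℝ≥0∞) ^ (i : ℝ)) ^ (θ - 1) :=
          ennreal_rpow_anti hi1.le (by linarith)
      _ = (2 : ℝ≥0∞) ^ ((1 - θ) + (θ - 1) * ((i + 1 : ℤ) : ℝ)) := by
          rw [← ENNReal.rpow_mul]; congr 1; push_cast; ring
      _ ≤ _ := by
          rw [two_rpow_add]
          gcongr
          calc (2 : ℝ≥0∞) ^ (1 - θ) ≤ 2 ^ (1 : ℝ) :=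
                ENNReal.rpow_le_rpow_of_exponent_le (by norm_num) (by linarith)
            _ = 2 := ENNReal.rpow_one _

lemma lintegral_comp_smul_of_pos {E : Type*} [NormedAddCommGroup E] [NormedSpace ℝ E]
    [MeasurableSpace E] [BorelSpace E] [FiniteDimensional ℝ E] (μ : Measure E)
    [μ.IsAddHaarMeasure] (f : E → ℝ≥0∞) {r : ℝ} (hr : 0 < r) :
    ∫⁻ x, f (r • x) ∂μ = ENNReal.ofReal ((r ^ Module.finrank ℝ E)⁻¹) * ∫⁻ x, f x ∂μ := by
  have hemb : MeasurableEmbedding (fun x : E => r • x) :=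
    (Homeomorph.smulOfNeZero r hr.ne').measurableEmbedding
  rw [← hemb.lintegral_map f, Measure.map_addHaar_smul μ hr.ne', lintegral_smul_measure,
    abs_of_pos (by positivity), smul_eq_mul]

lemma cns_pos (n : ℕ) {s : ℝ} (hs : 0 < s) : 0 < cns n s := by
  unfold cns
  have h1 : 0 < Real.Gamma (((n : ℝ) + s) / 2) := Real.Gamma_pos_of_pos (by positivity)
  have h2 : 0 < Real.Gamma (s / 2) := Real.Gamma_pos_of_pos (by positivity)
  positivity

lemma pker_nonneg (n : ℕ) {s t : ℝ} (hs : 0 < s) (ht : 0 < t) (x : EuclideanSpace ℝ (Fin n)) :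
    0 ≤ pker n s t x := by
  have := cns_pos n hs
  unfold pker
  positivity

lemma measurable_pker (n : ℕ) (s : ℝ) :
    Measurable fun z : ℝ × EuclideanSpace ℝ (Fin n) => pker n s z.1 z.2 := by
  unfold pker
  fun_prop

lemma measurable_pker_sub (n : ℕ) (s t : ℝ) (x : EuclideanSpace ℝ (Fin n)) :
    Measurable fun z => pker n s t (x - z) :=
  (measurable_pker n s).comp (measurable_const.prodMk (measurable_const.sub measurable_id))

lemma pker_eq_smul (n : ℕ) (s : ℝ) {t : ℝ} (ht : 0 < t) (x : EuclideanSpace ℝ (Fin n)) :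
    pker n s t x = (t ^ n)⁻¹ * pker n s 1 (t⁻¹ • x) := by
  unfold pker
  have h : ‖x‖ ^ 2 + t ^ 2 = t ^ 2 * (‖t⁻¹ • x‖ ^ 2 + 1 ^ 2) := by
    rw [norm_smul, Real.norm_of_nonneg (by positivity)]
    field_simp
  have h2 : (t ^ 2) ^ (-((n : ℝ) + s) / 2) = (t ^ n)⁻¹ * (t ^ s)⁻¹ := by
    rw [← Real.rpow_natCast t 2, ← Real.rpow_mul ht.le, ← Real.rpow_natCast t n,
      ← Real.rpow_neg ht.le, ← Real.rpow_neg ht.le, ← Real.rpow_add ht]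
    congr 1
    push_cast
    ring
  rw [h, Real.mul_rpow (by positivity) (by positivity), h2, Real.one_rpow]
  have : t ^ s ≠ 0 := (Real.rpow_pos_of_pos ht s).ne'
  field_simp

lemma lintegral_pker (n : ℕ) (s : ℝ) {t : ℝ} (ht : 0 < t) (x : EuclideanSpace ℝ (Fin n)) :
    ∫⁻ y, ENNReal.ofReal (pker n s t (x - y)) = ∫⁻ y, ENNReal.ofReal (pker n s 1 y) := by
  rw [lintegral_sub_left_eq_self (μ := volume)
    (f := fun y => ENNReal.ofReal (pker n s t y)) x]
  have h : ∀ y, ENNReal.ofReal (pker n s t y)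
      = ENNReal.ofReal ((t ^ n)⁻¹) * ENNReal.ofReal (pker n s 1 (t⁻¹ • y)) := fun y => by
    rw [pker_eq_smul n s ht, ENNReal.ofReal_mul (by positivity)]
  simp_rw [h]
  rw [lintegral_const_mul' _ _ ENNReal.ofReal_ne_top,
    lintegral_comp_smul_of_pos volume (fun y => ENNReal.ofReal (pker n s 1 y)) (inv_pos.2 ht),
    ← mul_assoc, ← ENNReal.ofReal_mul (by positivity)]
  simp [ht.ne']

lemma lintegral_pker_one_ne_top (n : ℕ) {s : ℝ} (hs : 0 < s) :
    ∫⁻ y : EuclideanSpace ℝ (Fin n), ENNReal.ofReal (pker n s 1 y) ≠ ∞ := by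
  have h : Integrable fun y : EuclideanSpace ℝ (Fin n) => pker n s 1 y := by
    have := (integrable_rpow_neg_one_add_norm_sq (E := EuclideanSpace ℝ (Fin n)) (μ := volume)
      (r := (n : ℝ) + s) (by simp [hs])).const_mul (cns n s)
    refine this.congr (Filter.Eventually.of_forall fun y => ?_)
    simp [pker, add_comm]
  exact h.lintegral_lt_top.ne

lemma pker_le (n : ℕ) {s t b : ℝ} (hs : 0 < s) (ht : 0 < t) (hb : 0 < b)
    (x : EuclideanSpace ℝ (Fin n)) (h : b ≤ ‖x‖ + t) :
    pker n s t x ≤ cns n s * ((b / 2) ^ n)⁻¹ := by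
  unfold pker
  have hc := cns_pos n hs
  set Q := ‖x‖ ^ 2 + t ^ 2 with hQ
  have hQpos : 0 < Q := by positivity
  have h1 : t ^ s ≤ Q ^ (s / 2) := by
    have : t ^ s = (t ^ 2) ^ (s / 2) := by
      rw [← Real.rpow_natCast t 2, ← Real.rpow_mul ht.le]
      congr 1
      push_cast
      ring
    rw [this]
    exact Real.rpow_le_rpow (by positivity) (by rw [hQ]; nlinarith [sq_nonneg ‖x‖]) (by positivity)
  have h2 : Q ^ (-(n : ℝ) / 2) ≤ ((b / 2) ^ n)⁻¹ := by
    have : ((b / 2) ^ n)⁻¹ = ((b / 2) ^ 2) ^ (-(n : ℝ) / 2) := by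
      rw [← Real.rpow_natCast (b / 2) 2, ← Real.rpow_mul (by positivity),
        ← Real.rpow_natCast (b / 2) n, ← Real.rpow_neg (by positivity)]
      congr 1
      push_cast
      ring
    rw [this]
    refine Real.rpow_le_rpow_of_nonpos (by positivity) ?_ ?_
    · have := norm_nonneg x
      nlinarith [sq_nonneg (‖x‖ - t)]
    · have : (0 : ℝ) ≤ n := n.cast_nonneg
      linarith
  calc cns n s * t ^ s * Q ^ (-((n : ℝ) + s) / 2)
      ≤ cns n s * Q ^ (s / 2) * Q ^ (-((n : ℝ) + s) / 2) := by gcongr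
    _ = cns n s * Q ^ (-(n : ℝ) / 2) := by
        rw [mul_assoc, ← Real.rpow_add hQpos]
        congr 2
        ring
    _ ≤ _ := by gcongr

/-- The mass which the Poisson kernel at `(x, t)` gives to a ball of radius `ρ` around `y` decays
like `(ρ / (|x - y| + t)) ^ n`. -/
lemma exists_setLIntegral_pker_le (n : ℕ) {s : ℝ} (hs : 0 < s) :
    ∃ K : ℝ≥0∞, K ≠ ∞ ∧ ∀ (t ρ : ℝ) (x y : EuclideanSpace ℝ (Fin n)) (m : ℕ), 0 < t → 0 < ρ →
      (m = 0 ∨ 2 ^ m * ρ ≤ ‖x - y‖ + t) →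
      ∫⁻ z in closedBall y ρ, ENNReal.ofReal (pker n s t (x - z)) ≤ K * 2 ^ (-(n : ℝ) * m) := by
  set K₀ := ∫⁻ y : EuclideanSpace ℝ (Fin n), ENNReal.ofReal (pker n s 1 y) with hK₀
  set ω := volume (closedBall (0 : EuclideanSpace ℝ (Fin n)) 1)
  have hω : ω ≠ ∞ := measure_closedBall_lt_top.ne
  have hc := cns_pos n hs
  refine ⟨K₀ + ENNReal.ofReal (cns n s * 4 ^ n) * ω, ENNReal.add_ne_top.2
    ⟨lintegral_pker_one_ne_top n hs, ENNReal.mul_ne_top ENNReal.ofReal_ne_top hω⟩,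
    fun t ρ x y m ht hρ hm => ?_⟩
  rcases Nat.eq_zero_or_pos m with rfl | hmpos
  · simp only [Nat.cast_zero, mul_zero, ENNReal.rpow_zero, mul_one]
    refine (setLIntegral_le_lintegral _ _).trans ?_
    rw [lintegral_pker n s ht]
    exact le_self_add
  have hm : 2 ^ m * ρ ≤ ‖x - y‖ + t := hm.resolve_left hmpos.ne'
  set a := ‖x - y‖ + t
  have ha : 0 < a := by positivity
  have h2 : 2 * ρ ≤ a := by
    refine le_trans ?_ hm
    gcongr
    exact le_self_pow₀ (by norm_num) hmpos.ne'
  have hpt : ∀ z ∈ closedBall y ρ, ENNReal.ofReal (pker n s t (x - z))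
      ≤ ENNReal.ofReal (cns n s * ((a / 4) ^ n)⁻¹) := fun z hz => by
    have hz : ‖z - y‖ ≤ ρ := by simpa [dist_eq_norm] using hz
    have htri : ‖x - y‖ ≤ ‖x - z‖ + ‖z - y‖ := by
      simpa using norm_add_le (x - z) (z - y)
    have := pker_le n hs ht (b := a / 2) (by positivity) (x - z) (by simp only [a] at *; linarith)
    rw [show a / 2 / 2 = a / 4 by ring] at this
    exact ENNReal.ofReal_le_ofReal this
  refine (setLIntegral_mono measurable_const hpt).trans ?_
  have hpow : (2 : ℝ≥0∞) ^ (-(n : ℝ) * m) = ENNReal.ofReal (((2 ^ m) ^ n)⁻¹) := by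
    rw [ENNReal.ofReal_inv_of_pos (by positivity), neg_mul, ENNReal.rpow_neg,
      ENNReal.ofReal_pow (by positivity), ENNReal.ofReal_pow (by positivity), mul_comm,
      ENNReal.rpow_mul, ENNReal.rpow_natCast, ENNReal.rpow_natCast]
    simp
  have hreal : cns n s * ((a / 4) ^ n)⁻¹ * ρ ^ n ≤ cns n s * 4 ^ n * ((2 ^ m) ^ n)⁻¹ := by
    have h3 : (2 ^ m) ^ n * ρ ^ n ≤ a ^ n := by
      rw [← mul_pow]
      gcongr
    have h4 : cns n s * ((a / 4) ^ n)⁻¹ * ρ ^ n = cns n s * 4 ^ n * (ρ ^ n / a ^ n) := by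
      rw [div_pow]
      field_simp
    rw [h4]
    gcongr
    rw [div_le_iff₀ (by positivity), inv_mul_eq_div, le_div_iff₀ (by positivity)]
    linarith
  rw [setLIntegral_const, Measure.addHaar_closedBall _ _ hρ.le, finrank_euclideanSpace_fin,
    ← mul_assoc, ← ENNReal.ofReal_mul (by positivity), hpow, add_mul]
  refine le_trans ?_ le_add_self
  rw [mul_right_comm (ENNReal.ofReal (cns n s * 4 ^ n)) ω, ← ENNReal.ofReal_mul (by positivity)]
  gcongr
  exact measure_mono ball_subset_closedBall

/-- The truncated cone `{(x, t) : t > 0, |x - y| + t ≤ R}`, contained in the tent over `B(y, R)`. -/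
def truncCone (n : ℕ) (y : EuclideanSpace ℝ (Fin n)) (R : ℝ) :
    Set (EuclideanSpace ℝ (Fin n) × ℝ) :=
  {z | 0 < z.2 ∧ ‖z.1 - y‖ + z.2 ≤ R}

lemma truncCone_subset_tent (n : ℕ) (y : EuclideanSpace ℝ (Fin n)) (R : ℝ) :
    truncCone n y R ⊆ tent n (ball y R) := by
  rintro ⟨x, t⟩ ⟨ht, h⟩
  refine ⟨ht, ball_subset_ball' ?_⟩
  rw [dist_eq_norm]
  linarith

lemma measurableSet_truncCone_prod (n : ℕ) (R : ℝ) :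
    MeasurableSet {w : (EuclideanSpace ℝ (Fin n) × ℝ) × EuclideanSpace ℝ (Fin n) |
      w.1 ∈ truncCone n w.2 R} := by
  have h1 : Measurable fun w : (EuclideanSpace ℝ (Fin n) × ℝ) × EuclideanSpace ℝ (Fin n) =>
      w.1.2 := by fun_prop
  have h2 : Measurable fun w : (EuclideanSpace ℝ (Fin n) × ℝ) × EuclideanSpace ℝ (Fin n) =>
      ‖w.1.1 - w.2‖ + w.1.2 := by fun_prop
  exact (measurableSet_lt measurable_const h1).inter (measurableSet_le h2 measurable_const)

lemma measurableSet_truncCone (n : ℕ) (y : EuclideanSpace ℝ (Fin n)) (R : ℝ) :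
    MeasurableSet (truncCone n y R) :=
  (measurableSet_truncCone_prod n R).preimage (measurable_id.prodMk measurable_const)

/-- Powers of the Poisson mass of a ball are dominated by a superposition of indicators of
truncated cones. -/
lemma exists_setLIntegral_pker_rpow_le (n : ℕ) {s p : ℝ} (hs : 0 < s) (hp : 0 < p) :
    ∃ K : ℝ≥0∞, K ≠ ∞ ∧ ∀ (t ρ : ℝ) (x y : EuclideanSpace ℝ (Fin n)), 0 < t → 0 < ρ →
      (∫⁻ z in closedBall y ρ, ENNReal.ofReal (pker n s t (x - z))) ^ p ≤
        K * ∑' m : ℕ, 2 ^ (-((n : ℝ) * p) * m) *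
          (truncCone n y (2 ^ m * ρ)).indicator (fun _ => 1) (x, t) := by
  obtain ⟨K, hK, hdecay⟩ := exists_setLIntegral_pker_le n hs
  refine ⟨K ^ p * 2 ^ ((n : ℝ) * p), ENNReal.mul_ne_top (ENNReal.rpow_ne_top_of_nonneg hp.le hK)
    (two_rpow_ne_top _), fun t ρ x y ht hρ => ?_⟩
  have key : ∀ m : ℕ, (m = 0 ∨ 2 ^ m * ρ ≤ ‖x - y‖ + t) →
      (∫⁻ z in closedBall y ρ, ENNReal.ofReal (pker n s t (x - z))) ^ p ≤
        K ^ p * 2 ^ (-((n : ℝ) * p) * m) := fun m hm => by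
    refine (ENNReal.rpow_le_rpow (hdecay t ρ x y m ht hρ hm) hp.le).trans_eq ?_
    rw [ENNReal.mul_rpow_of_nonneg _ _ hp.le, ← ENNReal.rpow_mul]
    congr 2
    ring
  rcases le_or_gt (‖x - y‖ + t) ρ with h | h
  · refine (key 0 (Or.inl rfl)).trans ?_
    rw [mul_assoc]
    gcongr K ^ p * ?_
    have h1 : (1 : ℝ≥0∞) ≤ 2 ^ ((n : ℝ) * p) := by
      rw [← ENNReal.rpow_zero (x := 2)]
      exact ENNReal.rpow_le_rpow_of_exponent_le (by norm_num) (by positivity)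
    refine le_trans ?_ (le_mul_of_one_le_left' h1)
    refine le_trans ?_ (ENNReal.le_tsum 0)
    rw [indicator_of_mem]
    · simp
    · exact ⟨ht, by simpa using h⟩
  · obtain ⟨m, hm1, hm2⟩ := exists_nat_pow_near (x := (‖x - y‖ + t) / ρ) (y := 2)
      (by rw [le_div_iff₀ hρ]; linarith) (by norm_num)
    rw [le_div_iff₀ hρ] at hm1
    rw [div_lt_iff₀ hρ] at hm2
    refine (key m (Or.inr hm1)).trans ?_
    rw [mul_assoc]
    gcongr K ^ p * ?_
    refine le_trans ?_ (mul_le_mul_right (ENNReal.le_tsum (m + 1)) _)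
    rw [indicator_of_mem, mul_one, ← two_rpow_add]
    · refine ENNReal.rpow_le_rpow_of_exponent_le (by norm_num) ?_
      push_cast
      linarith
    · exact ⟨ht, hm2.le⟩

lemma measurable_csExt (n : ℕ) (s : ℝ) {f : EuclideanSpace ℝ (Fin n) → ℝ} (hf : Measurable f) :
    Measurable fun z : EuclideanSpace ℝ (Fin n) × ℝ => csExt n s f z.1 z.2 := by
  have h : StronglyMeasurable fun w : (EuclideanSpace ℝ (Fin n) × ℝ) × EuclideanSpace ℝ (Fin n) =>
      pker n s w.1.2 (w.1.1 - w.2) * f w.2 := by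
    refine Measurable.stronglyMeasurable (Measurable.mul ?_ (by fun_prop))
    exact (measurable_pker n s).comp (by fun_prop :
      Measurable fun w : (EuclideanSpace ℝ (Fin n) × ℝ) × EuclideanSpace ℝ (Fin n) =>
        (w.1.2, w.1.1 - w.2))
  exact (h.integral_prod_right (ν := volume)).measurable

lemma ofReal_abs_csExt_le (n : ℕ) {s t : ℝ} (hs : 0 < s) (ht : 0 < t)
    (f : EuclideanSpace ℝ (Fin n) → ℝ) (x : EuclideanSpace ℝ (Fin n)) :
    ENNReal.ofReal |csExt n s f x t| ≤
      ∫⁻ z, ENNReal.ofReal (pker n s t (x - z)) * ENNReal.ofReal |f z| := by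
  rw [← Real.norm_eq_abs, ofReal_norm]
  refine (enorm_integral_le_lintegral_enorm _).trans_eq (lintegral_congr fun z => ?_)
  rw [enorm_mul, ← ofReal_norm, ← ofReal_norm, Real.norm_eq_abs,
    Real.norm_eq_abs, abs_of_nonneg (pker_nonneg n hs ht _)]

/-- Superlevel sets of the extension of a compactly supported function are bounded. -/
lemma exists_superlevel_subset_truncCone (n : ℕ) (hn : 1 ≤ n) {s : ℝ} (hs : 0 < s)
    {f : EuclideanSpace ℝ (Fin n) → ℝ} (hf : Continuous f) (hfc : HasCompactSupport f)
    {l : ℝ} (hl : 0 < l) :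
    ∃ R : ℝ, 0 < R ∧ {z | 0 < z.2 ∧ l < |csExt n s f z.1 z.2|} ⊆ truncCone n 0 R := by
  obtain ⟨K, hK, hdecay⟩ := exists_setLIntegral_pker_le n hs
  obtain ⟨M, hM⟩ := hfc.exists_bound_of_continuous hf
  obtain ⟨ρ, hρ, hsupp⟩ : ∃ ρ > 0, tsupport f ⊆ closedBall 0 ρ := by
    obtain ⟨ρ, h⟩ := hfc.isCompact.isBounded.subset_closedBall (0 : EuclideanSpace ℝ (Fin n))
    exact ⟨max ρ 1, by positivity, h.trans (closedBall_subset_closedBall (le_max_left _ _))⟩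
  have hlim : Filter.Tendsto (fun m : ℕ => ENNReal.ofReal M * K * 2 ^ (-(n : ℝ) * m))
      Filter.atTop (nhds 0) := by
    have h0 : Filter.Tendsto (fun m : ℕ => (2 : ℝ≥0∞) ^ (-(n : ℝ) * m)) Filter.atTop (nhds 0) :=
      ENNReal.tendsto_atTop_zero_of_tsum_ne_top
        (tsum_two_rpow_neg_ne_top (by exact_mod_cast hn))
    simpa using ENNReal.Tendsto.const_mul h0
      (Or.inr (ENNReal.mul_ne_top ENNReal.ofReal_ne_top hK))
  obtain ⟨m, hm⟩ := (hlim.eventually (gt_mem_nhds (ENNReal.ofReal_pos.2 hl))).exists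
  refine ⟨2 ^ m * ρ, by positivity, ?_⟩
  rintro ⟨x, t⟩ ⟨ht, hxt⟩
  refine ⟨ht, ?_⟩
  by_contra! hcon
  have h1 := hdecay t ρ x 0 m ht hρ (Or.inr hcon.le)
  have h2 : ENNReal.ofReal |csExt n s f x t| ≤ ENNReal.ofReal M * K * 2 ^ (-(n : ℝ) * m) := by
    refine (ofReal_abs_csExt_le n hs ht f x).trans ?_
    rw [mul_assoc]
    refine le_trans ?_ (mul_le_mul_right h1 _)
    rw [← lintegral_const_mul' _ _ ENNReal.ofReal_ne_top,
      ← lintegral_indicator measurableSet_closedBall]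
    refine lintegral_mono fun z => ?_
    by_cases hz : z ∈ closedBall (0 : EuclideanSpace ℝ (Fin n)) ρ
    · rw [indicator_of_mem hz, mul_comm]
      gcongr
      exact hM z
    · rw [image_eq_zero_of_notMem_tsupport fun h => hz (hsupp h)]
      simp
  have h3 := h2.trans_lt hm
  rw [ENNReal.ofReal_lt_ofReal_iff hl] at h3
  exact lt_asymm h3 hxt

lemma integrable_pker_mul (n : ℕ) {s t : ℝ} (hs : 0 < s) (ht : 0 < t)
    {f : EuclideanSpace ℝ (Fin n) → ℝ} (hf : Continuous f) (hfc : HasCompactSupport f)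
    (x : EuclideanSpace ℝ (Fin n)) : Integrable fun y => pker n s t (x - y) * f y := by
  obtain ⟨M, hM⟩ := hfc.exists_bound_of_continuous hf
  refine Integrable.mul_bdd (c := M) ?_ hf.aestronglyMeasurable (Filter.Eventually.of_forall hM)
  refine ⟨(measurable_pker_sub n s t x).aestronglyMeasurable, ?_⟩
  rw [hasFiniteIntegral_iff_ofReal (Filter.Eventually.of_forall fun y => pker_nonneg n hs ht _),
    lintegral_pker n s ht]
  exact (lintegral_pker_one_ne_top n hs).lt_top

/-- The extension of a nonnegative function which is at least `1` on a ball is bounded below on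
the tent over that ball. -/
lemma exists_le_csExt_on_tent (n : ℕ) {s : ℝ} (hs : 0 < s) :
    ∃ c : ℝ, 0 < c ∧ ∀ (f : EuclideanSpace ℝ (Fin n) → ℝ) (O : Set (EuclideanSpace ℝ (Fin n))),
      Continuous f → HasCompactSupport f → (∀ y, 0 ≤ f y) → (∀ y ∈ O, 1 ≤ f y) →
      ∀ z ∈ tent n O, c ≤ csExt n s f z.1 z.2 := by
  have hc := cns_pos n hs
  set ω := (volume (ball (0 : EuclideanSpace ℝ (Fin n)) 1)).toReal
  have hω : 0 < ω := ENNReal.toReal_pos (measure_ball_pos _ _ one_pos).ne' measure_ball_lt_top.ne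
  refine ⟨cns n s * 2 ^ (-((n : ℝ) + s) / 2) * ω, by positivity, ?_⟩
  rintro f O hf hfc hf0 hf1 ⟨x, t⟩ ⟨ht, hsub⟩
  simp only at ht hsub
  have hintg := integrable_pker_mul n hs ht hf hfc x
  have hpt : ∀ y ∈ ball x t, cns n s * 2 ^ (-((n : ℝ) + s) / 2) * (t ^ n)⁻¹
      ≤ pker n s t (x - y) * f y := fun y hy => by
    refine le_trans ?_ (le_mul_of_one_le_right (pker_nonneg n hs ht _) (hf1 y (hsub hy)))
    unfold pker
    rw [mem_ball, dist_comm, dist_eq_norm] at hy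
    have h2 : cns n s * 2 ^ (-((n : ℝ) + s) / 2) * (t ^ n)⁻¹
        = cns n s * t ^ s * (2 * t ^ 2) ^ (-((n : ℝ) + s) / 2) := by
      have h3 : (t ^ 2) ^ (-((n : ℝ) + s) / 2) = (t ^ n)⁻¹ * (t ^ s)⁻¹ := by
        rw [← Real.rpow_natCast t 2, ← Real.rpow_mul ht.le, ← Real.rpow_natCast t n,
          ← Real.rpow_neg ht.le, ← Real.rpow_neg ht.le, ← Real.rpow_add ht]
        congr 1
        push_cast
        ring
      rw [Real.mul_rpow (by positivity) (by positivity), h3]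
      have : t ^ s ≠ 0 := (Real.rpow_pos_of_pos ht s).ne'
      field_simp
    rw [h2]
    gcongr ?_ * ?_
    refine Real.rpow_le_rpow_of_nonpos (by positivity) ?_ ?_
    · have := norm_nonneg (x - y)
      nlinarith
    · have : (0 : ℝ) ≤ n := n.cast_nonneg
      linarith
  calc cns n s * 2 ^ (-((n : ℝ) + s) / 2) * ω
      = ∫ _ in ball x t, cns n s * 2 ^ (-((n : ℝ) + s) / 2) * (t ^ n)⁻¹ := by
        rw [setIntegral_const, Measure.real, Measure.addHaar_ball_of_pos _ _ ht,
          finrank_euclideanSpace_fin, ENNReal.toReal_mul,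
          ENNReal.toReal_ofReal (by positivity), smul_eq_mul]
        have : t ^ n ≠ 0 := by positivity
        field_simp
        rfl
    _ ≤ ∫ y in ball x t, pker n s t (x - y) * f y :=
        setIntegral_mono_on (integrableOn_const measure_ball_lt_top.ne) hintg.integrableOn
          measurableSet_ball hpt
    _ ≤ csExt n s f x t :=
        setIntegral_le_integral hintg (Filter.Eventually.of_forall fun y =>
          mul_nonneg (pker_nonneg n hs ht _) (hf0 y))

lemma hasFDerivAt_fwdDiff_iter {E F : Type*} [NormedAddCommGroup E] [NormedSpace ℝ E]
    [NormedAddCommGroup F] [NormedSpace ℝ F] {f : E → F} (hf : Differentiable ℝ f) (h : E) (k : ℕ)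
    (x : E) : HasFDerivAt ((fwdDiff h)^[k] f) ((fwdDiff h)^[k] (fderiv ℝ f) x) x := by
  induction k generalizing x with
  | zero => exact (hf x).hasFDerivAt
  | succ k ih =>
    rw [Function.iterate_succ_apply', Function.iterate_succ_apply']
    exact ((hasFDerivAt_comp_add_right h).2 (ih (x + h))).sub (ih x)

/-- The `k`-th difference of a test function is `O(‖h‖ ^ k)`, uniformly. -/
lemma exists_norm_fwdDiff_iter_le {E : Type} [NormedAddCommGroup E] [NormedSpace ℝ E]
    (k : ℕ) : ∀ {F : Type} [NormedAddCommGroup F] [NormedSpace ℝ F] {f : E → F},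
      ContDiff ℝ (⊤ : ℕ∞) f → HasCompactSupport f →
      ∃ M : ℝ, 0 ≤ M ∧ ∀ h x, ‖(fwdDiff h)^[k] f x‖ ≤ M * ‖h‖ ^ k := by
  induction k with
  | zero =>
    intro F _ _ f hf hfc
    obtain ⟨M, hM⟩ := hfc.exists_bound_of_continuous hf.continuous
    exact ⟨M, (norm_nonneg _).trans (hM 0), fun h x => by simpa using hM x⟩
  | succ k ih =>
    intro F _ _ f hf hfc
    have hd : Differentiable ℝ f := hf.differentiable (by simp)
    obtain ⟨M, hM0, hM⟩ := ih (hf.fderiv_right (m := (⊤ : ℕ∞)) (by simp)) (hfc.fderiv ℝ)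
    refine ⟨M, hM0, fun h x => ?_⟩
    rw [Function.iterate_succ_apply', pow_succ, ← mul_assoc]
    have := Convex.norm_image_sub_le_of_norm_hasFDerivWithin_le (s := univ) (x := x) (y := x + h)
      (fun y _ => (hasFDerivAt_fwdDiff_iter hd h k y).hasFDerivWithinAt)
      (fun y _ => hM h y) convex_univ (mem_univ _) (mem_univ _)
    simpa [fwdDiff] using this

lemma iterDiff_eq_fwdDiff (n : ℕ) (h : EuclideanSpace ℝ (Fin n)) (k : ℕ)
    (f : EuclideanSpace ℝ (Fin n) → ℝ) : iterDiff n h k f = (fwdDiff h)^[k] f := rfl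

lemma iterDiff_eq_sum (n : ℕ) (h : EuclideanSpace ℝ (Fin n)) (k : ℕ)
    (f : EuclideanSpace ℝ (Fin n) → ℝ) (x : EuclideanSpace ℝ (Fin n)) :
    (-1) ^ k * iterDiff n h k f x = f x -
      ∑ i ∈ Finset.range k, (-1) ^ i * (k.choose (i + 1) : ℝ) * f (x + ((i : ℝ) + 1) • h) := by
  rw [iterDiff_eq_fwdDiff, fwdDiff_iter_eq_sum_shift, Finset.mul_sum, Finset.sum_range_succ']
  rw [add_comm, sub_eq_add_neg, ← Finset.sum_neg_distrib]
  congr 1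
  · simp [← mul_assoc, ← pow_add, ← two_mul]
  · refine Finset.sum_congr rfl fun i hi => ?_
    obtain ⟨d, rfl⟩ : ∃ d, k = i + 1 + d := ⟨k - (i + 1), by grind⟩
    have h1 : (-1 : ℝ) ^ (i + 1 + d) * (-1) ^ d = - (-1) ^ i := by
      rw [← pow_add, show i + 1 + d + d = i + (1 + 2 * d) by ring, pow_add, pow_add, pow_mul]
      simp
    have h2 : (i + 1) • h = ((i : ℝ) + 1) • h := by
      rw [← Nat.cast_smul_eq_nsmul ℝ]
      simp
    rw [h2, zsmul_eq_mul]
    push_cast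
    rw [Nat.add_sub_cancel_left, ← mul_assoc, ← mul_assoc, h1]
    ring

lemma continuous_iterDiff (n : ℕ) (k : ℕ) {f : EuclideanSpace ℝ (Fin n) → ℝ} (hf : Continuous f) :
    Continuous fun z : EuclideanSpace ℝ (Fin n) × EuclideanSpace ℝ (Fin n) =>
      iterDiff n z.1 k f z.2 := by
  have h : ∀ z : EuclideanSpace ℝ (Fin n) × EuclideanSpace ℝ (Fin n), iterDiff n z.1 k f z.2 =
      (-1) ^ k * (f z.2 - ∑ i ∈ Finset.range k,
        (-1) ^ i * (k.choose (i + 1) : ℝ) * f (z.2 + ((i : ℝ) + 1) • z.1)) := fun z => by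
    rw [← iterDiff_eq_sum, ← mul_assoc, ← mul_pow]
    simp
  simp_rw [h]
  fun_prop

/-- Summing over dyadic scales the integrals over balls of comparable radius. -/
lemma tsum_scales_setLIntegral_le {E : Type*} [NormedAddCommGroup E] [MeasurableSpace E]
    [BorelSpace E] (μ : Measure E) {γ b : ℝ} (hγ : 0 < γ) (hb : 0 < b)
    {w : E → ℝ≥0∞} (hw : Measurable w) :
    ∑' j : ℤ, (2 : ℝ≥0∞) ^ (-γ * j) * ∫⁻ h in closedBall 0 (b * 2 ^ j), w h ∂μ ≤
      (∑' m : ℕ, (2 : ℝ≥0∞) ^ (-γ * m)) * ENNReal.ofReal b ^ γ *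
        ∫⁻ h, w h * ENNReal.ofReal ‖h‖ ^ (-γ) ∂μ := by
  have hb0 : ENNReal.ofReal b ≠ 0 := by simpa using hb
  have h1 : ∀ j : ℤ, (2 : ℝ≥0∞) ^ (-γ * j) * ∫⁻ h in closedBall 0 (b * 2 ^ j), w h ∂μ =
      ∫⁻ h, (closedBall 0 (b * 2 ^ j)).indicator (fun h => 2 ^ (-γ * j) * w h) h ∂μ := fun j => by
    rw [lintegral_indicator measurableSet_closedBall,
      lintegral_const_mul' _ _ (two_rpow_ne_top _)]
  simp_rw [h1]
  rw [← lintegral_tsum fun j => ((hw.const_mul _).indicator measurableSet_closedBall).aemeasurable]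
  rw [← lintegral_const_mul' _ _ (ENNReal.mul_ne_top (tsum_two_rpow_neg_ne_top hγ)
    (ENNReal.rpow_ne_top_of_nonneg hγ.le ENNReal.ofReal_ne_top))]
  refine lintegral_mono fun h => ?_
  have h2 : ∀ j : ℤ, (closedBall (0 : E) (b * 2 ^ j)).indicator (fun h => 2 ^ (-γ * j) * w h) h =
      (if ENNReal.ofReal ‖h‖ / ENNReal.ofReal b ≤ 2 ^ (j : ℝ) then 2 ^ (-γ * j) else 0) * w h := by
    intro j
    have h3 : h ∈ closedBall (0 : E) (b * 2 ^ j) ↔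
        ENNReal.ofReal ‖h‖ / ENNReal.ofReal b ≤ 2 ^ (j : ℝ) := by
      rw [ENNReal.div_le_iff hb0 ENNReal.ofReal_ne_top, ← ofReal_two_zpow,
        ← ENNReal.ofReal_mul (by positivity), ENNReal.ofReal_le_ofReal_iff (by positivity),
        mem_closedBall_zero_iff, mul_comm]
    by_cases hh : h ∈ closedBall (0 : E) (b * 2 ^ j)
    · rw [indicator_of_mem hh, if_pos (h3.1 hh)]
    · rw [indicator_of_notMem hh, if_neg (mt h3.2 hh), zero_mul]
  simp_rw [h2]
  rw [ENNReal.tsum_mul_right]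
  refine (mul_le_mul_left (tsum_scales_ge_le hγ _) _).trans_eq ?_
  rw [div_eq_mul_inv, ENNReal.mul_rpow_of_ne_top ENNReal.ofReal_ne_top (by simpa using hb),
    ENNReal.inv_rpow, ← ENNReal.rpow_neg, neg_neg]
  ring

lemma setLIntegral_closedBall_comp_smul (n : ℕ) (w : EuclideanSpace ℝ (Fin n) → ℝ≥0∞) {r : ℝ}
    (hr : 0 < r) :
    ∫⁻ h in closedBall 0 1, w (r • h) =
      ENNReal.ofReal ((r ^ n)⁻¹) * ∫⁻ h in closedBall 0 r, w h := by
  rw [← lintegral_indicator measurableSet_closedBall, ← lintegral_indicator measurableSet_closedBall]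
  have h := lintegral_comp_smul_of_pos volume ((closedBall 0 r).indicator w) hr
  rw [finrank_euclideanSpace_fin] at h
  rw [← h]
  refine lintegral_congr fun y => ?_
  have hmem : r • y ∈ closedBall (0 : EuclideanSpace ℝ (Fin n)) r ↔
      y ∈ closedBall (0 : EuclideanSpace ℝ (Fin n)) 1 := by
    rw [mem_closedBall_zero_iff, mem_closedBall_zero_iff, norm_smul,
      Real.norm_of_nonneg hr.le, mul_le_iff_le_one_right hr]
  by_cases hy : y ∈ closedBall (0 : EuclideanSpace ℝ (Fin n)) 1
  · rw [indicator_of_mem hy, indicator_of_mem (hmem.2 hy)]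
  · rw [indicator_of_notMem hy, indicator_of_notMem (mt hmem.1 hy)]

lemma setLIntegral_closedBall_comp_add (n : ℕ) (w : EuclideanSpace ℝ (Fin n) → ℝ≥0∞) (r : ℝ)
    (x : EuclideanSpace ℝ (Fin n)) :
    ∫⁻ h in closedBall 0 r, w (x + h) = ∫⁻ y in closedBall x r, w y := by
  rw [← lintegral_indicator measurableSet_closedBall, ← lintegral_indicator measurableSet_closedBall,
    ← lintegral_add_left_eq_self ((closedBall x r).indicator w) x]
  refine lintegral_congr fun y => ?_
  simp [indicator, mem_closedBall, dist_eq_norm]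

/-- Normalized Lebesgue measure on the closed unit ball. -/
def unitBallMean (n : ℕ) : Measure (EuclideanSpace ℝ (Fin n)) :=
  ProbabilityTheory.cond volume (closedBall 0 1)

instance isProbabilityMeasure_unitBallMean (n : ℕ) : IsProbabilityMeasure (unitBallMean n) :=
  ProbabilityTheory.cond_isProbabilityMeasure_of_finite
    (measure_closedBall_pos _ _ one_pos).ne' measure_closedBall_lt_top.ne

lemma lintegral_unitBallMean (n : ℕ) (w : EuclideanSpace ℝ (Fin n) → ℝ≥0∞) :
    ∫⁻ h, w h ∂(unitBallMean n) =
      (volume (closedBall (0 : EuclideanSpace ℝ (Fin n)) 1))⁻¹ * ∫⁻ h in closedBall 0 1, w h := by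
  rw [unitBallMean, ProbabilityTheory.cond, lintegral_smul_measure, smul_eq_mul]

lemma ae_unitBallMean_norm_le (n : ℕ) : ∀ᵐ h ∂(unitBallMean n), ‖h‖ ≤ 1 := by
  refine Measure.ae_smul_measure ?_ _
  filter_upwards [ae_restrict_mem measurableSet_closedBall] with h hh
  simpa using hh

/-- The combination of shifts of `g` which agrees with `g` up to a `k`-th difference. -/
def shiftSum (n k : ℕ) (g : EuclideanSpace ℝ (Fin n) → ℝ) (h x : EuclideanSpace ℝ (Fin n)) : ℝ :=
  ∑ i ∈ Finset.range k, (-1) ^ i * (k.choose (i + 1) : ℝ) * g (x + ((i : ℝ) + 1) • h)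

lemma sum_choose_succ_le (k : ℕ) : ∑ i ∈ Finset.range k, k.choose (i + 1) ≤ 2 ^ k := by
  rw [← Nat.sum_range_choose k, Finset.sum_range_succ']
  exact Nat.le_add_right _ _

lemma continuous_shiftSum (n k : ℕ) {g : EuclideanSpace ℝ (Fin n) → ℝ} (hg : Continuous g) :
    Continuous fun z : EuclideanSpace ℝ (Fin n) × EuclideanSpace ℝ (Fin n) =>
      shiftSum n k g z.1 z.2 := by
  unfold shiftSum
  fun_prop

lemma abs_shiftSum_le_sum (n k : ℕ) (g : EuclideanSpace ℝ (Fin n) → ℝ)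
    (h x : EuclideanSpace ℝ (Fin n)) :
    |shiftSum n k g h x| ≤
      ∑ i ∈ Finset.range k, (k.choose (i + 1) : ℝ) * |g (x + ((i : ℝ) + 1) • h)| := by
  refine (Finset.abs_sum_le_sum_abs _ _).trans_eq (Finset.sum_congr rfl fun i _ => ?_)
  simp [abs_mul]

lemma abs_shiftSum_le (n k : ℕ) {g : EuclideanSpace ℝ (Fin n) → ℝ} {M : ℝ} (hM : ∀ x, |g x| ≤ M)
    (h x : EuclideanSpace ℝ (Fin n)) : |shiftSum n k g h x| ≤ 2 ^ k * M := by
  have hM0 : 0 ≤ M := (abs_nonneg _).trans (hM 0)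
  refine (abs_shiftSum_le_sum n k g h x).trans ?_
  calc _ ≤ ∑ i ∈ Finset.range k, (k.choose (i + 1) : ℝ) * M := by
        gcongr
        exact hM _
    _ ≤ _ := by
        rw [← Finset.sum_mul]
        gcongr
        exact_mod_cast sum_choose_succ_le k

/-- The average of `shiftSum` over steps in the ball of radius `r`. -/
def avgShift (n k : ℕ) (r : ℝ) (g : EuclideanSpace ℝ (Fin n) → ℝ)
    (x : EuclideanSpace ℝ (Fin n)) : ℝ :=
  ∫ h, shiftSum n k g (r • h) x ∂(unitBallMean n)

lemma integrable_shiftSum (n k : ℕ) (r : ℝ) {g : EuclideanSpace ℝ (Fin n) → ℝ} {M : ℝ}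
    (hg : Continuous g) (hM : ∀ x, |g x| ≤ M) (x : EuclideanSpace ℝ (Fin n)) :
    Integrable (fun h => shiftSum n k g (r • h) x) (unitBallMean n) := by
  refine Integrable.of_bound (Continuous.aestronglyMeasurable ?_) (2 ^ k * M)
    (Filter.Eventually.of_forall fun h => abs_shiftSum_le n k hM _ _)
  exact (continuous_shiftSum n k hg).comp (by fun_prop : Continuous fun h => (r • h, x))

lemma continuous_avgShift (n k : ℕ) (r : ℝ) {g : EuclideanSpace ℝ (Fin n) → ℝ} {M : ℝ}
    (hg : Continuous g) (hM : ∀ x, |g x| ≤ M) : Continuous (avgShift n k r g) := by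
  refine continuous_of_dominated (bound := fun _ => 2 ^ k * M)
    (fun x => (integrable_shiftSum n k r hg hM x).aestronglyMeasurable)
    (fun x => Filter.Eventually.of_forall fun h => abs_shiftSum_le n k hM _ _)
    (integrable_const _) (Filter.Eventually.of_forall fun h => ?_)
  exact (continuous_shiftSum n k hg).comp (by fun_prop : Continuous fun x => (r • h, x))

lemma abs_avgShift_le (n k : ℕ) (r : ℝ) {g : EuclideanSpace ℝ (Fin n) → ℝ} {M : ℝ}
    (hM : ∀ x, |g x| ≤ M) (x : EuclideanSpace ℝ (Fin n)) : |avgShift n k r g x| ≤ 2 ^ k * M := by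
  have := norm_integral_le_of_norm_le_const (μ := unitBallMean n)
    (f := fun h => shiftSum n k g (r • h) x)
    (Filter.Eventually.of_forall fun h => abs_shiftSum_le n k hM (r • h) x)
  simpa [avgShift] using this

lemma avgShift_sub (n k : ℕ) (r : ℝ) {f g : EuclideanSpace ℝ (Fin n) → ℝ} {M N : ℝ}
    (hf : Continuous f) (hM : ∀ x, |f x| ≤ M) (hg : Continuous g) (hN : ∀ x, |g x| ≤ N)
    (x : EuclideanSpace ℝ (Fin n)) :
    avgShift n k r (fun y => f y - g y) x = avgShift n k r f x - avgShift n k r g x := by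
  unfold avgShift
  rw [← integral_sub (integrable_shiftSum n k r hf hM x) (integrable_shiftSum n k r hg hN x)]
  refine integral_congr_ae (Filter.Eventually.of_forall fun h => ?_)
  simp [shiftSum, mul_sub]

lemma avgShift_avgShift (n k : ℕ) (a b : ℝ) {f : EuclideanSpace ℝ (Fin n) → ℝ} {M : ℝ}
    (hf : Continuous f) (hM : ∀ x, |f x| ≤ M) (x : EuclideanSpace ℝ (Fin n)) :
    avgShift n k a (avgShift n k b f) x =
      ∫ h, ∫ h', shiftSum n k (shiftSum n k f (b • h')) (a • h) x
        ∂(unitBallMean n) ∂(unitBallMean n) := by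
  refine integral_congr_ae (Filter.Eventually.of_forall fun h => ?_)
  simp only
  rw [shiftSum]
  simp_rw [avgShift, ← integral_const_mul]
  rw [← integral_finsetSum _ fun i _ => (integrable_shiftSum n k b hf hM _).const_mul _]
  rfl

lemma shiftSum_comm (n k : ℕ) (f : EuclideanSpace ℝ (Fin n) → ℝ)
    (h h' x : EuclideanSpace ℝ (Fin n)) :
    shiftSum n k (shiftSum n k f h') h x = shiftSum n k (shiftSum n k f h) h' x := by
  simp only [shiftSum, Finset.mul_sum]
  rw [Finset.sum_comm]
  refine Finset.sum_congr rfl fun i _ => Finset.sum_congr rfl fun l _ => ?_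
  rw [add_right_comm]
  ring

lemma avgShift_comm (n k : ℕ) (a b : ℝ) {f : EuclideanSpace ℝ (Fin n) → ℝ} {M : ℝ}
    (hf : Continuous f) (hM : ∀ x, |f x| ≤ M) (x : EuclideanSpace ℝ (Fin n)) :
    avgShift n k a (avgShift n k b f) x = avgShift n k b (avgShift n k a f) x := by
  rw [avgShift_avgShift n k a b hf hM, avgShift_avgShift n k b a hf hM, integral_integral_swap]
  · simp_rw [shiftSum_comm n k f (a • _) (b • _) x]
  · refine Integrable.of_bound (C := 2 ^ k * (2 ^ k * M)) (Continuous.aestronglyMeasurable ?_)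
      (Filter.Eventually.of_forall fun z => abs_shiftSum_le n k (abs_shiftSum_le n k hM _) _ _)
    simp only [shiftSum]
    fun_prop

lemma ofReal_abs_sub_avgShift_le (n k : ℕ) (r : ℝ) {f : EuclideanSpace ℝ (Fin n) → ℝ} {M : ℝ}
    (hf : Continuous f) (hM : ∀ x, |f x| ≤ M) (x : EuclideanSpace ℝ (Fin n)) :
    ENNReal.ofReal |f x - avgShift n k r f x| ≤
      ∫⁻ h, ENNReal.ofReal |iterDiff n (r • h) k f x| ∂(unitBallMean n) := by
  have h1 : f x - avgShift n k r f x =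
      ∫ h, (-1) ^ k * iterDiff n (r • h) k f x ∂(unitBallMean n) := by
    have h2 := integral_sub (integrable_const (f x)) (integrable_shiftSum n k r hf hM x)
    simp only [integral_const, probReal_univ, one_smul] at h2
    rw [avgShift, ← h2]
    simp_rw [iterDiff_eq_sum]
    rfl
  rw [h1, ← Real.norm_eq_abs, ofReal_norm]
  refine (enorm_integral_le_lintegral_enorm _).trans_eq (lintegral_congr fun h => ?_)
  rw [← ofReal_norm, Real.norm_eq_abs, abs_mul]
  simp

/-- Pointwise bound of `avgShift` by the mean of the absolute value over a ball. -/
lemma ofReal_abs_avgShift_le (n k : ℕ) {r : ℝ} (hr : 0 < r) {g : EuclideanSpace ℝ (Fin n) → ℝ}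
    (hg : Continuous g) (x : EuclideanSpace ℝ (Fin n)) :
    ENNReal.ofReal |avgShift n k r g x| ≤
      2 ^ k * (volume (closedBall (0 : EuclideanSpace ℝ (Fin n)) 1))⁻¹ *
        ENNReal.ofReal ((r ^ n)⁻¹) * ∫⁻ y in closedBall x (k * r), ENNReal.ofReal |g y| := by
  set ω := volume (closedBall (0 : EuclideanSpace ℝ (Fin n)) 1)
  have hterm : ∀ i ∈ Finset.range k,
      ∫⁻ h, ENNReal.ofReal |g (x + ((i : ℝ) + 1) • r • h)| ∂(unitBallMean n) ≤
        ω⁻¹ * (ENNReal.ofReal ((r ^ n)⁻¹) *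
          ∫⁻ y in closedBall x (k * r), ENNReal.ofReal |g y|) := fun i hi => by
    have hi : (i : ℝ) + 1 ≤ k := by exact_mod_cast Finset.mem_range.1 hi
    rw [lintegral_unitBallMean]
    refine mul_le_mul_right ?_ _
    simp_rw [smul_smul]
    rw [setLIntegral_closedBall_comp_smul n (fun h => ENNReal.ofReal |g (x + h)|)
        (by positivity : (0 : ℝ) < ((i : ℝ) + 1) * r),
      setLIntegral_closedBall_comp_add n (fun y => ENNReal.ofReal |g y|)]
    gcongr ENNReal.ofReal (?_ ^ n)⁻¹ * ?_
    · exact le_mul_of_one_le_left hr.le (by simp)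
    · exact lintegral_mono_set (closedBall_subset_closedBall (by gcongr))
  have hmeas : ∀ i ∈ Finset.range k, Measurable fun h => (k.choose (i + 1) : ℝ≥0∞) *
      ENNReal.ofReal |g (x + ((i : ℝ) + 1) • r • h)| := fun i _ => by
    have := hg.measurable
    fun_prop
  calc ENNReal.ofReal |avgShift n k r g x|
      ≤ ∫⁻ h, ENNReal.ofReal |shiftSum n k g (r • h) x| ∂(unitBallMean n) := by
        rw [← Real.norm_eq_abs, ofReal_norm]
        refine (enorm_integral_le_lintegral_enorm _).trans_eq (lintegral_congr fun h => ?_)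
        rw [← ofReal_norm, Real.norm_eq_abs]
    _ ≤ ∫⁻ h, ∑ i ∈ Finset.range k, (k.choose (i + 1) : ℝ≥0∞) *
          ENNReal.ofReal |g (x + ((i : ℝ) + 1) • r • h)| ∂(unitBallMean n) := by
        refine lintegral_mono fun h => ?_
        refine (ENNReal.ofReal_le_ofReal (abs_shiftSum_le_sum n k g _ _)).trans_eq ?_
        rw [ENNReal.ofReal_sum_of_nonneg fun i _ => by positivity]
        refine Finset.sum_congr rfl fun i _ => ?_
        rw [ENNReal.ofReal_mul (by positivity), ENNReal.ofReal_natCast]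
    _ = ∑ i ∈ Finset.range k, (k.choose (i + 1) : ℝ≥0∞) *
          ∫⁻ h, ENNReal.ofReal |g (x + ((i : ℝ) + 1) • r • h)| ∂(unitBallMean n) := by
        rw [lintegral_finsetSum _ hmeas]
        refine Finset.sum_congr rfl fun i _ => ?_
        rw [lintegral_const_mul' _ _ (ENNReal.natCast_ne_top _)]
    _ ≤ ∑ i ∈ Finset.range k, (k.choose (i + 1) : ℝ≥0∞) * (ω⁻¹ * (ENNReal.ofReal ((r ^ n)⁻¹) *
          ∫⁻ y in closedBall x (k * r), ENNReal.ofReal |g y|)) :=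
        Finset.sum_le_sum fun i hi => mul_le_mul_right (hterm i hi) _
    _ ≤ _ := by
        rw [← Finset.sum_mul, mul_assoc, mul_assoc]
        gcongr
        exact_mod_cast sum_choose_succ_le k

lemma exists_abs_sub_avgShift_le (n k : ℕ) {f : EuclideanSpace ℝ (Fin n) → ℝ}
    (hf : ContDiff ℝ (⊤ : ℕ∞) f) (hfc : HasCompactSupport f) :
    ∃ M : ℝ, 0 ≤ M ∧ ∀ r : ℝ, 0 ≤ r → ∀ x, |f x - avgShift n k r f x| ≤ M * r ^ k := by
  obtain ⟨B, hB⟩ := hfc.exists_bound_of_continuous hf.continuous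
  obtain ⟨M, hM0, hM⟩ := exists_norm_fwdDiff_iter_le k hf hfc
  refine ⟨M, hM0, fun r hr x => ?_⟩
  rw [← ENNReal.ofReal_le_ofReal_iff (by positivity)]
  refine (ofReal_abs_sub_avgShift_le n k r hf.continuous hB x).trans ?_
  calc _ ≤ ∫⁻ _, ENNReal.ofReal (M * r ^ k) ∂(unitBallMean n) := by
        refine lintegral_mono_ae ?_
        filter_upwards [ae_unitBallMean_norm_le n] with h hh
        refine ENNReal.ofReal_le_ofReal ((hM (r • h) x).trans ?_)
        rw [norm_smul, Real.norm_of_nonneg hr]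
        gcongr
        exact mul_le_of_le_one_right hr hh
    _ = _ := by simp

lemma exists_abs_avgShift_le_inv_pow (n k : ℕ) {f : EuclideanSpace ℝ (Fin n) → ℝ}
    (hf : Continuous f) (hfc : HasCompactSupport f) :
    ∃ A : ℝ, 0 ≤ A ∧ ∀ r : ℝ, 0 < r → ∀ x, |avgShift n k r f x| ≤ A * (r ^ n)⁻¹ := by
  set ω := volume (closedBall (0 : EuclideanSpace ℝ (Fin n)) 1)
  set I := ∫⁻ y, ENNReal.ofReal |f y|
  have hI : I ≠ ∞ := (hf.integrable_of_hasCompactSupport hfc).abs.lintegral_lt_top.ne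
  have hω : ω⁻¹ ≠ ∞ := ENNReal.inv_ne_top.2 (measure_closedBall_pos _ _ one_pos).ne'
  have hA : 2 ^ k * ω⁻¹ * I ≠ ∞ :=
    ENNReal.mul_ne_top (ENNReal.mul_ne_top (ENNReal.pow_ne_top (by simp)) hω) hI
  refine ⟨(2 ^ k * ω⁻¹ * I).toReal, ENNReal.toReal_nonneg, fun r hr x => ?_⟩
  rw [← ENNReal.ofReal_le_ofReal_iff (by positivity), ENNReal.ofReal_mul ENNReal.toReal_nonneg,
    ENNReal.ofReal_toReal hA]
  refine (ofReal_abs_avgShift_le n k hr hf x).trans ?_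
  rw [mul_right_comm]
  gcongr
  exact setLIntegral_le_lintegral _ _

/-- A test function is recovered from the telescoping series of its double averages. -/
lemma ofReal_abs_le_tsum_avgShift (n k : ℕ) (hn : 1 ≤ n) (hk : 1 ≤ k)
    {f : EuclideanSpace ℝ (Fin n) → ℝ} (hf : ContDiff ℝ (⊤ : ℕ∞) f) (hfc : HasCompactSupport f)
    (x : EuclideanSpace ℝ (Fin n)) :
    ENNReal.ofReal |f x| ≤ ∑' j : ℤ, ENNReal.ofReal
      |avgShift n k (2 * 2 ^ j) (fun y => avgShift n k (2 ^ j) f y - avgShift n k (4 * 2 ^ j) f y) x|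
      := by
  obtain ⟨B, hB⟩ := hfc.exists_bound_of_continuous hf.continuous
  obtain ⟨M, hM0, hM⟩ := exists_abs_sub_avgShift_le n k hf hfc
  obtain ⟨A, hA0, hA⟩ := exists_abs_avgShift_le_inv_pow n k hf.continuous hfc
  have hcont : ∀ r, Continuous (avgShift n k r f) := fun r =>
    continuous_avgShift n k r hf.continuous hB
  have hbdd : ∀ r y, |avgShift n k r f y| ≤ 2 ^ k * B := fun r y => abs_avgShift_le n k r hB y
  set F : ℤ → ℝ := fun j => avgShift n k (2 * 2 ^ j) (avgShift n k (2 ^ j) f) x with hF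
  have hstep : ∀ j : ℤ, avgShift n k (2 * 2 ^ j)
      (fun y => avgShift n k (2 ^ j) f y - avgShift n k (4 * 2 ^ j) f y) x = F j - F (j + 1) := by
    intro j
    have h2 : (2 : ℝ) ^ (j + 1) = 2 * 2 ^ j := by
      rw [zpow_add₀ (by norm_num), zpow_one, mul_comm]
    rw [avgShift_sub n k _ (hcont _) (hbdd _) (hcont _) (hbdd _), hF]
    simp only
    rw [h2, ← mul_assoc, show (2 : ℝ) * 2 = 4 by norm_num,
      avgShift_comm n k (4 * 2 ^ j) (2 * 2 ^ j) hf.continuous hB]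
  simp_rw [hstep]
  refine ofReal_abs_le_tsum_of_tendsto ?_ ?_
  · have hbound : ∀ N : ℕ, |F (-N) - f x| ≤ 2 ^ k * M * 2 * ((2 : ℝ)⁻¹ ^ N) := fun N => by
      have hr : (2 : ℝ) ^ (-(N : ℤ)) = (2 : ℝ)⁻¹ ^ N := by simp
      simp only [hF]
      rw [hr]
      set r := (2 : ℝ)⁻¹ ^ N
      have hr0 : 0 ≤ r := by positivity
      have hr1 : r ^ k ≤ r := pow_le_of_le_one hr0 (pow_le_one₀ (by norm_num) (by norm_num))
        (by omega)
      have e1 : |avgShift n k (2 * r) (fun y => f y - avgShift n k r f y) x| ≤ 2 ^ k * (M * r ^ k) :=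
        abs_avgShift_le n k _ (hM r hr0) x
      rw [avgShift_sub n k _ hf.continuous hB (hcont _) (hbdd _)] at e1
      have e2 := hM (2 * r) (by positivity) x
      rw [mul_pow] at e2
      have e3 := abs_sub_le (avgShift n k (2 * r) (avgShift n k r f) x) (avgShift n k (2 * r) f x)
        (f x)
      rw [abs_sub_comm] at e1 e2
      have e4 : 2 ^ k * M * r ^ k ≤ 2 ^ k * M * r := by gcongr
      linarith
    rw [tendsto_iff_dist_tendsto_zero]
    refine squeeze_zero (fun _ => dist_nonneg) hbound ?_
    simpa using (tendsto_pow_atTop_nhds_zero_of_lt_one (r := (2 : ℝ)⁻¹) (by norm_num)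
      (by norm_num)).const_mul (2 ^ k * M * 2)
  · have hbound : ∀ N : ℕ, |F N| ≤ 2 ^ k * A * ((2 : ℝ)⁻¹ ^ N) := fun N => by
      simp only [hF, zpow_natCast]
      have e1 := abs_avgShift_le n k (2 * 2 ^ N) (hA (2 ^ N) (by positivity)) x
      refine e1.trans ?_
      rw [← mul_assoc, inv_pow]
      gcongr
      exact le_self_pow₀ (one_le_pow₀ (by norm_num)) (by omega)
    refine squeeze_zero_norm hbound ?_
    simpa using (tendsto_pow_atTop_nhds_zero_of_lt_one (r := (2 : ℝ)⁻¹) (by norm_num)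
      (by norm_num)).const_mul (2 ^ k * A)

/-- Tonelli for integrals over balls against the Poisson kernel. -/
lemma lintegral_pker_mul_setLIntegral (n : ℕ) (s t κ : ℝ) (x : EuclideanSpace ℝ (Fin n))
    {W : EuclideanSpace ℝ (Fin n) → ℝ≥0∞} (hW : Measurable W) :
    ∫⁻ z, ENNReal.ofReal (pker n s t (x - z)) * ∫⁻ y in closedBall z κ, W y =
      ∫⁻ y, W y * ∫⁻ z in closedBall y κ, ENNReal.ofReal (pker n s t (x - z)) := by
  have hpk := (measurable_pker_sub n s t x).ennreal_ofReal
  have hset : MeasurableSet {w : EuclideanSpace ℝ (Fin n) × EuclideanSpace ℝ (Fin n) |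
      dist w.1 w.2 ≤ κ} := measurableSet_le (by fun_prop) measurable_const
  have hmeas : Measurable fun w : EuclideanSpace ℝ (Fin n) × EuclideanSpace ℝ (Fin n) =>
      {w : EuclideanSpace ℝ (Fin n) × EuclideanSpace ℝ (Fin n) | dist w.1 w.2 ≤ κ}.indicator
        (fun w => ENNReal.ofReal (pker n s t (x - w.1)) * W w.2) w :=
    Measurable.indicator ((hpk.comp measurable_fst).mul (hW.comp measurable_snd)) hset
  have h1 : ∀ z, ENNReal.ofReal (pker n s t (x - z)) * ∫⁻ y in closedBall z κ, W y =
      ∫⁻ y, {w : EuclideanSpace ℝ (Fin n) × EuclideanSpace ℝ (Fin n) | dist w.1 w.2 ≤ κ}.indicator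
        (fun w => ENNReal.ofReal (pker n s t (x - w.1)) * W w.2) (z, y) := fun z => by
    rw [← lintegral_const_mul' _ _ ENNReal.ofReal_ne_top,
      ← lintegral_indicator measurableSet_closedBall]
    refine lintegral_congr fun y => ?_
    simp [indicator, mem_closedBall, dist_comm]
  have h2 : ∀ y, W y * ∫⁻ z in closedBall y κ, ENNReal.ofReal (pker n s t (x - z)) =
      ∫⁻ z, {w : EuclideanSpace ℝ (Fin n) × EuclideanSpace ℝ (Fin n) | dist w.1 w.2 ≤ κ}.indicator
        (fun w => ENNReal.ofReal (pker n s t (x - w.1)) * W w.2) (z, y) := fun y => by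
    rw [← lintegral_const_mul _ hpk, ← lintegral_indicator measurableSet_closedBall]
    refine lintegral_congr fun z => ?_
    simp [indicator, mem_closedBall, mul_comm]
  simp_rw [h1, h2]
  exact lintegral_lintegral_swap hmeas.aemeasurable

/-- The Besov energy `∫∫ |Δ_h^k f(x)|^p dx |h|^{-γ} dh` as an extended nonnegative number. -/
def besovEnergy (n k : ℕ) (γ p : ℝ) (f : EuclideanSpace ℝ (Fin n) → ℝ) : ℝ≥0∞ :=
  ∫⁻ h, (∫⁻ x, ENNReal.ofReal |iterDiff n h k f x| ^ p) * ENNReal.ofReal ‖h‖ ^ (-γ)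

/-- The `p`-th power of the extension of every test function is dominated by a superposition over
dyadic scales of powers of Poisson masses of balls, with total weight controlled by the Besov
energy. -/
def HasScaleDomination (n k : ℕ) (s p β : ℝ) : Prop :=
  ∃ C : ℝ≥0∞, C ≠ ∞ ∧ ∃ κ : ℝ, 0 < κ ∧ ∀ f : EuclideanSpace ℝ (Fin n) → ℝ,
    ContDiff ℝ (⊤ : ℕ∞) f → HasCompactSupport f →
    ∃ W : ℤ → EuclideanSpace ℝ (Fin n) → ℝ≥0∞, (∀ j, Measurable (W j)) ∧
      (∀ x t, 0 < t → ENNReal.ofReal |csExt n s f x t| ^ p ≤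
        ∑' j : ℤ, ∫⁻ y, W j y *
          (∫⁻ z in closedBall y (κ * 2 ^ j), ENNReal.ofReal (pker n s t (x - z))) ^ p) ∧
      ∑' j : ℤ, 2 ^ (((n : ℝ) - p * β) * j) * ∫⁻ y, W j y ≤
        C * besovEnergy n k ((n : ℝ) + β * p) p f

lemma ofReal_two_zpow_pow_inv (n : ℕ) (j : ℤ) :
    ENNReal.ofReal ((((2 : ℝ) ^ j) ^ n)⁻¹) = 2 ^ (-(n : ℝ) * j) := by
  rw [ENNReal.ofReal_inv_of_pos (by positivity), ENNReal.ofReal_pow (by positivity),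
    ofReal_two_zpow, ← ENNReal.rpow_natCast, ← ENNReal.rpow_mul, ← ENNReal.rpow_neg]
  congr 1
  ring

lemma measurable_lintegral_iterDiff (n k : ℕ) (p : ℝ) {f : EuclideanSpace ℝ (Fin n) → ℝ}
    (hf : Continuous f) : Measurable fun h => ∫⁻ x, ENNReal.ofReal |iterDiff n h k f x| ^ p := by
  have h := (continuous_iterDiff n k hf).measurable
  exact Measurable.lintegral_prod_right' (f := fun z : _ × _ =>
    ENNReal.ofReal |iterDiff n z.1 k f z.2| ^ p) (by fun_prop)

lemma hasScaleDomination_one (n k : ℕ) (hn : 1 ≤ n) (hk : 1 ≤ k) {s β : ℝ} (hs : 0 < s)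
    (hβ : 0 < β) : HasScaleDomination n k s 1 β := by
  set ω := volume (closedBall (0 : EuclideanSpace ℝ (Fin n)) 1)
  have hω : ω⁻¹ ≠ ∞ := ENNReal.inv_ne_top.2 (measure_closedBall_pos _ _ one_pos).ne'
  set K : ℝ≥0∞ := 2 ^ k * ω⁻¹
  have hK : K ≠ ∞ := ENNReal.mul_ne_top (ENNReal.pow_ne_top (by simp)) hω
  have hγ : 0 < (n : ℝ) + β * 1 := by positivity
  set S : ℝ≥0∞ := ∑' m : ℕ, (2 : ℝ≥0∞) ^ (-((n : ℝ) + β * 1) * m)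
  have hS : S ≠ ∞ := tsum_two_rpow_neg_ne_top hγ
  refine ⟨K * (1 + 2 ^ (2 * β)) * (ω⁻¹ * S), ENNReal.mul_ne_top (ENNReal.mul_ne_top hK
    (ENNReal.add_ne_top.2 ⟨by simp, two_rpow_ne_top _⟩)) (ENNReal.mul_ne_top hω hS), 2 * k,
    by positivity, fun f hf hfc => ?_⟩
  obtain ⟨B, hB⟩ := hfc.exists_bound_of_continuous hf.continuous
  have hdiff := (continuous_iterDiff n k hf.continuous).measurable
  set G : ℝ → EuclideanSpace ℝ (Fin n) → ℝ≥0∞ := fun r y =>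
    ∫⁻ h, ENNReal.ofReal |iterDiff n (r • h) k f y| ∂(unitBallMean n) with hG
  have hGmeas : ∀ r, Measurable (G r) := fun r => by
    refine Measurable.lintegral_prod_right' (f := fun z : _ × _ =>
      ENNReal.ofReal |iterDiff n (r • z.2) k f z.1|) ?_
    have : Measurable fun z : EuclideanSpace ℝ (Fin n) × EuclideanSpace ℝ (Fin n) =>
      (r • z.2, z.1) := by fun_prop
    have := hdiff.comp this
    exact this.abs.ennreal_ofReal
  set w : EuclideanSpace ℝ (Fin n) → ℝ≥0∞ := fun h =>
    ∫⁻ x, ENNReal.ofReal |iterDiff n h k f x| ^ (1 : ℝ) with hw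
  have hwmeas : Measurable w := measurable_lintegral_iterDiff n k 1 hf.continuous
  have hGint : ∀ j : ℤ, ∫⁻ y, G (2 ^ j) y =
      ω⁻¹ * (2 ^ (-(n : ℝ) * j) * ∫⁻ h in closedBall 0 (1 * 2 ^ j), w h) := fun j => by
    rw [one_mul, ← ofReal_two_zpow_pow_inv, ← setLIntegral_closedBall_comp_smul n w (by positivity),
      ← lintegral_unitBallMean, hG]
    simp only [hw, ENNReal.rpow_one]
    refine lintegral_lintegral_swap (Measurable.aemeasurable ?_)
    have : Measurable fun z : EuclideanSpace ℝ (Fin n) × EuclideanSpace ℝ (Fin n) =>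
      (((2 : ℝ) ^ j) • z.2, z.1) := by fun_prop
    have := hdiff.comp this
    exact this.abs.ennreal_ofReal
  refine ⟨fun j y => K * 2 ^ (-(n : ℝ) * j) * (G (2 ^ j) y + G (2 ^ (j + 2)) y),
    fun j => ((hGmeas _).add (hGmeas _)).const_mul _, fun x t ht => ?_, ?_⟩
  · simp only [ENNReal.rpow_one]
    have hpt : ∀ z, ENNReal.ofReal |f z| ≤ ∑' j : ℤ, ∫⁻ y in closedBall z (2 * k * 2 ^ j),
        K * 2 ^ (-(n : ℝ) * j) * (G (2 ^ j) y + G (2 ^ (j + 2)) y) := fun z => by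
      refine (ofReal_abs_le_tsum_avgShift n k hn hk hf hfc z).trans (ENNReal.tsum_le_tsum fun j => ?_)
      have hc : ∀ r, Continuous (avgShift n k r f) := fun r =>
        continuous_avgShift n k r hf.continuous hB
      refine (ofReal_abs_avgShift_le n k (by positivity) ((hc _).sub (hc _)) z).trans ?_
      rw [lintegral_const_mul' _ _ (ENNReal.mul_ne_top hK (two_rpow_ne_top _)),
        ← ofReal_two_zpow_pow_inv, show (k : ℝ) * (2 * 2 ^ j) = 2 * k * 2 ^ j by ring]
      gcongr K * ENNReal.ofReal (?_ ^ n)⁻¹ * ?_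
      · have : (0 : ℝ) < 2 ^ j := by positivity
        linarith
      · refine lintegral_mono fun y => ?_
        rw [show (2 : ℝ) ^ (j + 2) = 4 * 2 ^ j by
          rw [zpow_add₀ (by norm_num), mul_comm]; norm_num]
        refine le_trans ?_ (add_le_add (ofReal_abs_sub_avgShift_le n k (2 ^ j) hf.continuous hB y)
          (ofReal_abs_sub_avgShift_le n k (4 * 2 ^ j) hf.continuous hB y))
        rw [← ENNReal.ofReal_add (abs_nonneg _) (abs_nonneg _)]
        refine ENNReal.ofReal_le_ofReal ?_
        rw [abs_sub_comm (f y) (avgShift n k (2 ^ j) f y)]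
        exact abs_sub_le _ _ _
    refine (ofReal_abs_csExt_le n hs ht f x).trans ?_
    refine (lintegral_mono fun z => mul_le_mul_right (hpt z) _).trans_eq ?_
    simp_rw [← ENNReal.tsum_mul_left]
    rw [lintegral_tsum]
    · refine tsum_congr fun j => ?_
      exact lintegral_pker_mul_setLIntegral n s t _ x (((hGmeas _).add (hGmeas _)).const_mul _)
    · intro j
      refine Measurable.aemeasurable ((measurable_pker_sub n s t x).ennreal_ofReal.mul ?_)
      simp_rw [← lintegral_indicator measurableSet_closedBall]
      refine Measurable.lintegral_prod_right' (f := fun z : _ × _ =>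
        (closedBall z.1 (2 * k * 2 ^ j)).indicator (fun y => K * 2 ^ (-(n : ℝ) * j) *
          (G (2 ^ j) y + G (2 ^ (j + 2)) y)) z.2) ?_
      have hset : MeasurableSet {w : EuclideanSpace ℝ (Fin n) × EuclideanSpace ℝ (Fin n) |
        dist w.2 w.1 ≤ 2 * k * 2 ^ j} := measurableSet_le (by fun_prop) measurable_const
      exact Measurable.indicator ((((hGmeas _).add (hGmeas _)).const_mul
        (K * 2 ^ (-(n : ℝ) * j))).comp measurable_snd) hset
  · set I : ℤ → ℝ≥0∞ := fun j => 2 ^ (-β * j) * ∫⁻ y, G (2 ^ j) y with hI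
    have hterm : ∀ j : ℤ, (2 : ℝ≥0∞) ^ (((n : ℝ) - 1 * β) * j) *
        ∫⁻ y, K * 2 ^ (-(n : ℝ) * j) * (G (2 ^ j) y + G (2 ^ (j + 2)) y) =
        K * (I j + 2 ^ (2 * β) * I (j + 2)) := fun j => by
      rw [lintegral_const_mul' _ _ (ENNReal.mul_ne_top hK (two_rpow_ne_top _)),
        lintegral_add_left (hGmeas _)]
      have e1 : (2 : ℝ≥0∞) ^ (((n : ℝ) - 1 * β) * j) * 2 ^ (-(n : ℝ) * j) = 2 ^ (-β * j) := by
        rw [← two_rpow_add]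
        congr 1
        ring
      have e2 : (2 : ℝ≥0∞) ^ (2 * β) * 2 ^ (-β * ((j + 2 : ℤ) : ℝ)) = 2 ^ (-β * j) := by
        rw [← two_rpow_add]
        congr 1
        push_cast
        ring
      simp only [hI]
      rw [← mul_assoc (2 ^ (2 * β)), e2, ← mul_add, ← e1]
      ring
    have hsum : ∑' j, I j ≤ ω⁻¹ * S * besovEnergy n k ((n : ℝ) + β * 1) 1 f := by
      have e1 : ∀ j : ℤ, I j = ω⁻¹ * (2 ^ (-((n : ℝ) + β * 1) * j) *
          ∫⁻ h in closedBall 0 (1 * 2 ^ j), w h) := fun j => by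
        simp only [hI]
        rw [hGint, show -((n : ℝ) + β * 1) * j = -β * j + -(n : ℝ) * j by ring, two_rpow_add]
        ring
      simp_rw [e1]
      rw [ENNReal.tsum_mul_left, mul_assoc]
      refine mul_le_mul_right ?_ _
      refine (tsum_scales_setLIntegral_le volume hγ one_pos hwmeas).trans_eq ?_
      simp [besovEnergy, hw, S]
    simp_rw [hterm]
    rw [ENNReal.tsum_mul_left, ENNReal.tsum_add, ENNReal.tsum_mul_left,
      show ∑' j, I (j + 2) = ∑' j, I j from (Equiv.addRight (2 : ℤ)).tsum_eq I]
    calc K * (∑' j, I j + 2 ^ (2 * β) * ∑' j, I j)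
        = K * (1 + 2 ^ (2 * β)) * ∑' j, I j := by ring
      _ ≤ _ := by
        rw [mul_assoc (K * _)]
        gcongr

/-- The index of the dyadic cube of side `2 ^ j` containing `y`. -/
def cubeIdx (n : ℕ) (j : ℤ) (y : EuclideanSpace ℝ (Fin n)) : Fin n → ℤ :=
  fun i => ⌊y i / 2 ^ j⌋

/-- The dyadic cube of side `2 ^ j` with a given index. -/
def dyadicCube (n : ℕ) (j : ℤ) (a : Fin n → ℤ) : Set (EuclideanSpace ℝ (Fin n)) :=
  cubeIdx n j ⁻¹' {a}

lemma measurable_cubeIdx (n : ℕ) (j : ℤ) : Measurable (cubeIdx n j) :=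
  measurable_pi_iff.2 fun i => Int.measurable_floor.comp
    (by fun_prop : Measurable fun y : EuclideanSpace ℝ (Fin n) => y i / 2 ^ j)

lemma measurableSet_dyadicCube (n : ℕ) (j : ℤ) (a : Fin n → ℤ) :
    MeasurableSet (dyadicCube n j a) :=
  measurable_cubeIdx n j (measurableSet_singleton a)

lemma cubeIdx_succ (n : ℕ) (j : ℤ) (y : EuclideanSpace ℝ (Fin n)) :
    cubeIdx n (j + 1) y = fun i => cubeIdx n j y i / 2 := by
  funext i
  have h : y i / 2 ^ (j + 1) = (y i / 2 ^ j) / (2 : ℕ) := by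
    rw [zpow_add₀ (by norm_num), zpow_one, div_div, Nat.cast_ofNat]
  rw [cubeIdx, h, Int.floor_div_natCast]
  rfl

lemma volume_dyadicCube (n : ℕ) (j : ℤ) (a : Fin n → ℤ) :
    volume (dyadicCube n j a) = 2 ^ ((n : ℝ) * j) := by
  have h : dyadicCube n j a = (WithLp.ofLp : EuclideanSpace ℝ (Fin n) → Fin n → ℝ) ⁻¹'
      univ.pi fun i => Ico ((a i : ℝ) * 2 ^ j) (((a i : ℝ) + 1) * 2 ^ j) := by
    ext y
    have hpos : (0 : ℝ) < 2 ^ j := by positivity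
    simp only [dyadicCube, mem_preimage, mem_singleton_iff, funext_iff, cubeIdx, Int.floor_eq_iff,
      mem_univ_pi, mem_Ico, le_div_iff₀ hpos, div_lt_iff₀ hpos]
  rw [h, (PiLp.volume_preserving_ofLp (Fin n)).measure_preimage
    (MeasurableSet.univ_pi fun i => measurableSet_Ico).nullMeasurableSet, Real.volume_pi_Ico]
  have e : ∀ i, ((a i : ℝ) + 1) * 2 ^ j - (a i : ℝ) * 2 ^ j = 2 ^ j := fun i => by ring
  simp_rw [e, ofReal_two_zpow]
  rw [Finset.prod_const, Finset.card_univ, Fintype.card_fin, ← ENNReal.rpow_natCast,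
    ← ENNReal.rpow_mul, mul_comm]

lemma dist_le_of_cubeIdx_eq (n : ℕ) {j : ℤ} {x y : EuclideanSpace ℝ (Fin n)}
    (h : cubeIdx n j x = cubeIdx n j y) : dist x y ≤ n * 2 ^ j := by
  have hpos : (0 : ℝ) < 2 ^ j := by positivity
  have hcoord : ∀ i, dist (x i) (y i) ≤ 2 ^ j := fun i => by
    have h1 := Int.abs_sub_lt_one_of_floor_eq_floor (congrFun h i)
    rw [← sub_div, abs_div, abs_of_pos hpos, div_lt_one hpos] at h1
    exact h1.le
  rw [EuclideanSpace.dist_eq, Real.sqrt_le_left (by positivity)]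
  calc ∑ i, dist (x i) (y i) ^ 2 ≤ ∑ _i : Fin n, ((2 : ℝ) ^ j) ^ 2 := by
        gcongr with i
        exact hcoord i
    _ = n * (2 ^ j) ^ 2 := by simp
    _ ≤ (n * 2 ^ j) ^ 2 := by
        rw [mul_pow]
        gcongr
        rcases Nat.eq_zero_or_pos n with rfl | hn
        · simp
        · exact le_self_pow₀ (by exact_mod_cast hn) (by norm_num)

lemma dyadicCube_subset_closedBall (n : ℕ) {j : ℤ} {a : Fin n → ℤ} {x : EuclideanSpace ℝ (Fin n)}
    (hx : x ∈ dyadicCube n j a) : dyadicCube n j a ⊆ closedBall x (n * 2 ^ j) := fun _ hy =>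
  dist_le_of_cubeIdx_eq n ((mem_singleton_iff.1 hy).trans (mem_singleton_iff.1 hx).symm)

lemma lintegral_eq_tsum_dyadicCube (n : ℕ) (j : ℤ) (g : EuclideanSpace ℝ (Fin n) → ℝ≥0∞) :
    ∫⁻ y, g y = ∑' a, ∫⁻ y in dyadicCube n j a, g y := by
  have huniv : ⋃ a, dyadicCube n j a = univ :=
    eq_univ_of_forall fun y => mem_iUnion.2 ⟨cubeIdx n j y, rfl⟩
  rw [← lintegral_iUnion (measurableSet_dyadicCube n j), huniv, setLIntegral_univ]
  intro a b hab
  exact (disjoint_singleton.2 hab).preimage _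

/-- A good sampling point in a dyadic cube: the oscillation around the value there is at most the
mean oscillation. -/
lemma exists_sample_point (n : ℕ) {p : ℝ} {f : EuclideanSpace ℝ (Fin n) → ℝ} (hf : Continuous f)
    (j : ℤ) (a : Fin n → ℤ) : ∃ x ∈ dyadicCube n j a,
      ∫⁻ y in dyadicCube n j a, ENNReal.ofReal |f x - f y| ^ p ≤
        2 ^ (-(n : ℝ) * j) * ∫⁻ x in dyadicCube n j a, ∫⁻ y in dyadicCube n j a,
          ENNReal.ofReal |f x - f y| ^ p := by
  have hV := volume_dyadicCube n j a
  have hm := hf.measurable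
  obtain ⟨x, hx, h⟩ := exists_le_setLAverage (μ := volume) (s := dyadicCube n j a)
    (f := fun x => ∫⁻ y in dyadicCube n j a, ENNReal.ofReal |f x - f y| ^ p)
    (by rw [hV]; exact two_rpow_ne_zero _) (by rw [hV]; exact two_rpow_ne_top _)
    (Measurable.aemeasurable (Measurable.lintegral_prod_right' (f := fun z : _ × _ =>
      ENNReal.ofReal |f z.1 - f z.2| ^ p) (by fun_prop)))
  refine ⟨x, hx, h.trans_eq ?_⟩
  rw [setLAverage_eq, hV, neg_mul, ENNReal.rpow_neg, ENNReal.div_eq_inv_mul]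

lemma ofReal_abs_sub_rpow_le {p : ℝ} (hp : 0 ≤ p) (hp1 : p ≤ 1) (a b c : ℝ) :
    ENNReal.ofReal |a - c| ^ p ≤ ENNReal.ofReal |a - b| ^ p + ENNReal.ofReal |b - c| ^ p := by
  refine le_trans ?_ (ENNReal.rpow_add_le_add_rpow _ _ hp hp1)
  refine ENNReal.rpow_le_rpow ?_ hp
  rw [← ENNReal.ofReal_add (abs_nonneg _) (abs_nonneg _)]
  exact ENNReal.ofReal_le_ofReal (abs_sub_le _ _ _)

lemma lintegral_ofReal_abs_rpow_ne_top (n : ℕ) {p : ℝ} (hp : 0 < p)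
    {f : EuclideanSpace ℝ (Fin n) → ℝ} (hf : Continuous f) (hfc : HasCompactSupport f) :
    ∫⁻ y, ENNReal.ofReal |f y| ^ p ≠ ∞ := by
  have h : Integrable fun y => |f y| ^ p := by
    refine Continuous.integrable_of_hasCompactSupport
      (hf.abs.rpow_const fun _ => Or.inr hp.le) ?_
    exact hfc.comp_left (g := fun v : ℝ => |v| ^ p) (by simp [hp.ne'])
  have h2 := h.lintegral_lt_top.ne
  simp_rw [ENNReal.ofReal_rpow_of_nonneg (abs_nonneg _) hp.le]
  exact h2

section DyadicSampling

variable {n : ℕ} {p : ℝ} {f : EuclideanSpace ℝ (Fin n) → ℝ}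
  {c : ℤ → (Fin n → ℤ) → EuclideanSpace ℝ (Fin n)}

lemma measurable_sample (f : EuclideanSpace ℝ (Fin n) → ℝ)
    (c : ℤ → (Fin n → ℤ) → EuclideanSpace ℝ (Fin n)) (j : ℤ) :
    Measurable fun y => f (c j (cubeIdx n j y)) :=
  (measurable_of_countable fun a => f (c j a)).comp (measurable_cubeIdx n j)

lemma cubeIdx_sample (hc : ∀ j a, c j a ∈ dyadicCube n j a) (j : ℤ) (a : Fin n → ℤ) :
    cubeIdx n j (c j a) = a := hc j a

lemma lintegral_sample_sub_le (hf : Continuous f)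
    (hosc : ∀ j a, ∫⁻ y in dyadicCube n j a, ENNReal.ofReal |f (c j a) - f y| ^ p ≤
        2 ^ (-(n : ℝ) * j) * ∫⁻ x in dyadicCube n j a, ∫⁻ y in dyadicCube n j a,
          ENNReal.ofReal |f x - f y| ^ p) (j : ℤ) :
    ∫⁻ y, ENNReal.ofReal |f (c j (cubeIdx n j y)) - f y| ^ p ≤
      2 ^ (-(n : ℝ) * j) * ∫⁻ h in closedBall 0 (n * 2 ^ j),
        ∫⁻ x, ENNReal.ofReal |iterDiff n h 1 f x| ^ p := by
  have hm := hf.measurable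
  rw [lintegral_eq_tsum_dyadicCube n j]
  calc _ ≤ ∑' a, 2 ^ (-(n : ℝ) * j) * ∫⁻ x in dyadicCube n j a,
        ∫⁻ h in closedBall 0 (n * 2 ^ j), ENNReal.ofReal |iterDiff n h 1 f x| ^ p := by
        refine ENNReal.tsum_le_tsum fun a => ?_
        rw [setLIntegral_congr_fun (measurableSet_dyadicCube n j a)
          (g := fun y => ENNReal.ofReal |f (c j a) - f y| ^ p)
          (fun y hy => by simp only; rw [mem_singleton_iff.1 hy])]
        refine (hosc j a).trans (mul_le_mul_right ?_ _)
        refine setLIntegral_mono' (measurableSet_dyadicCube n j a) fun x hx => ?_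
        refine (lintegral_mono_set (dyadicCube_subset_closedBall n hx)).trans_eq ?_
        rw [← setLIntegral_closedBall_comp_add n (fun y => ENNReal.ofReal |f x - f y| ^ p)]
        simp [iterDiff, abs_sub_comm]
    _ = 2 ^ (-(n : ℝ) * j) * ∫⁻ x, ∫⁻ h in closedBall 0 (n * 2 ^ j),
          ENNReal.ofReal |iterDiff n h 1 f x| ^ p := by
        rw [ENNReal.tsum_mul_left, ← lintegral_eq_tsum_dyadicCube]
    _ = _ := by
        congr 1
        refine lintegral_lintegral_swap (Measurable.aemeasurable ?_)
        simp only [iterDiff, Function.iterate_one]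
        fun_prop

lemma ofReal_abs_sample_rpow_le (hp : 0 ≤ p) (hp1 : p ≤ 1) (hf : Continuous f)
    (hosc : ∀ j a, ∫⁻ y in dyadicCube n j a, ENNReal.ofReal |f (c j a) - f y| ^ p ≤
        2 ^ (-(n : ℝ) * j) * ∫⁻ x in dyadicCube n j a, ∫⁻ y in dyadicCube n j a,
          ENNReal.ofReal |f x - f y| ^ p) (j : ℤ) (a : Fin n → ℤ) :
    ENNReal.ofReal |f (c j a)| ^ p ≤
      2 ^ (-(n : ℝ) * j) * (3 * ∫⁻ y, ENNReal.ofReal |f y| ^ p) := by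
  set V : ℝ≥0∞ := 2 ^ ((n : ℝ) * j)
  have hV : volume (dyadicCube n j a) = V := volume_dyadicCube n j a
  have hV0 : V ≠ 0 := two_rpow_ne_zero _
  have hVt : V ≠ ∞ := two_rpow_ne_top _
  have hVinv : (2 : ℝ≥0∞) ^ (-(n : ℝ) * j) = V⁻¹ := by rw [neg_mul, ENNReal.rpow_neg]
  have hm := hf.measurable
  set I := ∫⁻ y in dyadicCube n j a, ENNReal.ofReal |f y| ^ p
  have htri : ∀ u v : ℝ, ENNReal.ofReal |u - v| ^ p ≤
      ENNReal.ofReal |u| ^ p + ENNReal.ofReal |v| ^ p := fun u v => by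
    simpa using ofReal_abs_sub_rpow_le hp hp1 u 0 v
  have h1 : ∫⁻ y in dyadicCube n j a, ENNReal.ofReal |f (c j a) - f y| ^ p ≤ 2 * I := by
    refine (hosc j a).trans ?_
    rw [hVinv]
    calc _ ≤ V⁻¹ * ∫⁻ x in dyadicCube n j a, ∫⁻ y in dyadicCube n j a,
          (ENNReal.ofReal |f x| ^ p + ENNReal.ofReal |f y| ^ p) := by
          gcongr
          exact htri _ _
      _ = V⁻¹ * (V * I + V * I) := by
          have e : ∀ x, ∫⁻ y in dyadicCube n j a,
              (ENNReal.ofReal |f x| ^ p + ENNReal.ofReal |f y| ^ p) =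
              V * ENNReal.ofReal |f x| ^ p + I := fun x => by
            rw [lintegral_add_left measurable_const, setLIntegral_const, hV, mul_comm]
          simp_rw [e]
          rw [lintegral_add_right _ measurable_const, lintegral_const_mul' _ _ hVt,
            setLIntegral_const, hV, mul_comm I V]
      _ = 2 * I := by
          rw [← mul_add, ← mul_assoc, ENNReal.inv_mul_cancel hV0 hVt, one_mul, two_mul]
  have h2 : V * ENNReal.ofReal |f (c j a)| ^ p ≤ 3 * I := by
    calc V * ENNReal.ofReal |f (c j a)| ^ p
        = ∫⁻ _ in dyadicCube n j a, ENNReal.ofReal |f (c j a)| ^ p := by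
          rw [setLIntegral_const, hV, mul_comm]
      _ ≤ ∫⁻ y in dyadicCube n j a,
          (ENNReal.ofReal |f (c j a) - f y| ^ p + ENNReal.ofReal |f y| ^ p) := by
          refine lintegral_mono fun y => ?_
          simpa using ofReal_abs_sub_rpow_le hp hp1 (f (c j a)) (f y) 0
      _ ≤ 2 * I + I := by
          rw [lintegral_add_right _ (by fun_prop)]
          gcongr
      _ = 3 * I := by ring
  rw [hVinv, ← ENNReal.div_eq_inv_mul, ENNReal.le_div_iff_mul_le (Or.inl hV0) (Or.inl hVt),
    mul_comm]
  exact h2.trans (mul_le_mul_right (setLIntegral_le_lintegral _ _) _)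

lemma ofReal_abs_le_tsum_sample (hn : 1 ≤ n) (hp : 0 < p) (hp1 : p ≤ 1) (hf : Continuous f)
    (hfc : HasCompactSupport f) (hc : ∀ j a, c j a ∈ dyadicCube n j a)
    (hosc : ∀ j a, ∫⁻ y in dyadicCube n j a, ENNReal.ofReal |f (c j a) - f y| ^ p ≤
        2 ^ (-(n : ℝ) * j) * ∫⁻ x in dyadicCube n j a, ∫⁻ y in dyadicCube n j a,
          ENNReal.ofReal |f x - f y| ^ p) (y : EuclideanSpace ℝ (Fin n)) :
    ENNReal.ofReal |f y| ≤ ∑' j : ℤ, ENNReal.ofReal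
      |f (c j (cubeIdx n j y)) - f (c (j + 1) (cubeIdx n (j + 1) y))| := by
  refine ofReal_abs_le_tsum_of_tendsto (F := fun j => f (c j (cubeIdx n j y))) ?_ ?_
  · refine (hf.tendsto y).comp ?_
    rw [tendsto_iff_dist_tendsto_zero]
    refine squeeze_zero (fun _ => dist_nonneg)
      (fun N => dist_le_of_cubeIdx_eq n (cubeIdx_sample hc _ _)) ?_
    have h := (tendsto_pow_atTop_nhds_zero_of_lt_one (r := (2 : ℝ)⁻¹) (by norm_num)
      (by norm_num)).const_mul (n : ℝ)
    simpa using h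
  · set I := ∫⁻ y, ENNReal.ofReal |f y| ^ p
    have hI : 3 * I ≠ ∞ :=
      ENNReal.mul_ne_top (by simp) (lintegral_ofReal_abs_rpow_ne_top n hp hf hfc)
    have h0 : Filter.Tendsto (fun m : ℕ => (2 : ℝ≥0∞) ^ (-(n : ℝ) * m) * (3 * I))
        Filter.atTop (nhds 0) := by
      have h0 : Filter.Tendsto (fun m : ℕ => (2 : ℝ≥0∞) ^ (-(n : ℝ) * m)) Filter.atTop (nhds 0) :=
        ENNReal.tendsto_atTop_zero_of_tsum_ne_top
          (tsum_two_rpow_neg_ne_top (by exact_mod_cast hn))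
      simpa using ENNReal.Tendsto.mul_const h0 (Or.inr hI)
    have h1 := tendsto_of_tendsto_of_tendsto_of_le_of_le tendsto_const_nhds h0 (fun _ => zero_le)
      (fun N : ℕ => by
        simpa using ofReal_abs_sample_rpow_le hp.le hp1 hf hosc N (cubeIdx n N y))
    have h2 := h1.ennrpow_const (1 / p)
    rw [ENNReal.zero_rpow_of_pos (by positivity)] at h2
    have h3 := (ENNReal.tendsto_toReal ENNReal.zero_ne_top).comp h2
    refine squeeze_zero_norm (fun N => le_of_eq ?_) h3
    simp only [Function.comp]
    rw [← ENNReal.rpow_mul, mul_one_div_cancel hp.ne', ENNReal.rpow_one,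
      ENNReal.toReal_ofReal (abs_nonneg _), Real.norm_eq_abs]

end DyadicSampling

lemma hasScaleDomination_of_le_one (n : ℕ) (hn : 1 ≤ n) {s p β : ℝ} (hs : 0 < s) (hp : 0 < p)
    (hp1 : p ≤ 1) (hβ : 0 < β) : HasScaleDomination n 1 s p β := by
  have hγ : 0 < (n : ℝ) + β * p := by positivity
  have hnpos : (0 : ℝ) < n := by exact_mod_cast hn
  set S : ℝ≥0∞ := (∑' m : ℕ, (2 : ℝ≥0∞) ^ (-((n : ℝ) + β * p) * m)) *
    ENNReal.ofReal n ^ ((n : ℝ) + β * p)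
  have hS : S ≠ ∞ := ENNReal.mul_ne_top (tsum_two_rpow_neg_ne_top hγ)
    (ENNReal.rpow_ne_top_of_nonneg hγ.le ENNReal.ofReal_ne_top)
  refine ⟨(1 + 2 ^ (p * β)) * S, ENNReal.mul_ne_top
    (ENNReal.add_ne_top.2 ⟨by simp, two_rpow_ne_top _⟩) hS, n, hnpos, fun f hf hfc => ?_⟩
  choose c hc hosc using fun j a => exists_sample_point n (p := p) hf.continuous j a
  set a : ℤ → EuclideanSpace ℝ (Fin n) → ℝ≥0∞ := fun j y => ENNReal.ofReal
    |f (c j (cubeIdx n j y)) - f (c (j + 1) (cubeIdx n (j + 1) y))| with ha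
  have hsm := fun j => measurable_sample f c j
  have hameas : ∀ j, Measurable (a j) := fun j =>
    ((hsm j).sub (hsm (j + 1))).abs.ennreal_ofReal
  have hconst : ∀ j b, ∀ y ∈ dyadicCube n j b, a j y = a j (c j b) := fun j b y hy => by
    simp only [ha]
    rw [cubeIdx_succ, cubeIdx_succ, mem_singleton_iff.1 hy, cubeIdx_sample hc]
  refine ⟨fun j y => 2 ^ (-(n : ℝ) * j) * a j y ^ p,
    fun j => ((hameas j).pow_const p).const_mul _, fun x t ht => ?_, ?_⟩
  · have hpk := (measurable_pker_sub n s t x).ennreal_ofReal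
    calc ENNReal.ofReal |csExt n s f x t| ^ p
        ≤ (∫⁻ z, ENNReal.ofReal (pker n s t (x - z)) * ∑' j, a j z) ^ p := by
          refine ENNReal.rpow_le_rpow ((ofReal_abs_csExt_le n hs ht f x).trans ?_) hp.le
          refine lintegral_mono fun z => mul_le_mul_right ?_ _
          exact ofReal_abs_le_tsum_sample hn hp hp1 hf.continuous hfc hc hosc z
      _ = (∑' j, ∑' b, a j (c j b) *
            ∫⁻ z in dyadicCube n j b, ENNReal.ofReal (pker n s t (x - z))) ^ p := by
          congr 1
          simp_rw [← ENNReal.tsum_mul_left]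
          have hprod : ∀ j, Measurable fun z => ENNReal.ofReal (pker n s t (x - z)) * a j z :=
            fun j => hpk.mul (hameas j)
          rw [lintegral_tsum fun j => (hprod j).aemeasurable]
          refine tsum_congr fun j => ?_
          rw [lintegral_eq_tsum_dyadicCube n j]
          refine tsum_congr fun b => ?_
          rw [← lintegral_const_mul _ hpk]
          refine setLIntegral_congr_fun (measurableSet_dyadicCube n j b) fun z hz => ?_
          rw [hconst j b z hz, mul_comm]
      _ ≤ ∑' j, ∑' b, (a j (c j b) *
            ∫⁻ z in dyadicCube n j b, ENNReal.ofReal (pker n s t (x - z))) ^ p := by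
          refine (tsum_rpow_le _ hp hp1).trans (ENNReal.tsum_le_tsum fun j => ?_)
          exact tsum_rpow_le _ hp hp1
      _ ≤ ∑' j : ℤ, ∑' b, ∫⁻ y in dyadicCube n j b, 2 ^ (-(n : ℝ) * j) * a j y ^ p *
            (∫⁻ z in closedBall y (n * 2 ^ j), ENNReal.ofReal (pker n s t (x - z))) ^ p := by
          refine ENNReal.tsum_le_tsum fun j => ENNReal.tsum_le_tsum fun b => ?_
          rw [ENNReal.mul_rpow_of_nonneg _ _ hp.le]
          set J := (∫⁻ z in dyadicCube n j b, ENNReal.ofReal (pker n s t (x - z))) ^ p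
          calc a j (c j b) ^ p * J
              = ∫⁻ _ in dyadicCube n j b, 2 ^ (-(n : ℝ) * j) * a j (c j b) ^ p * J := by
                rw [setLIntegral_const, volume_dyadicCube, mul_comm _ (2 ^ ((n : ℝ) * j)),
                  ← mul_assoc, ← mul_assoc, ← two_rpow_add]
                simp
            _ ≤ _ := by
                refine setLIntegral_mono' (measurableSet_dyadicCube n j b) fun y hy => ?_
                rw [hconst j b y hy]
                exact mul_le_mul_right (ENNReal.rpow_le_rpow (lintegral_mono_set
                  (dyadicCube_subset_closedBall n hy)) hp.le) _
      _ = _ := by simp_rw [← lintegral_eq_tsum_dyadicCube]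
  · set w : EuclideanSpace ℝ (Fin n) → ℝ≥0∞ := fun h =>
      ∫⁻ x, ENNReal.ofReal |iterDiff n h 1 f x| ^ p with hw
    have hwmeas : Measurable w := measurable_lintegral_iterDiff n 1 p hf.continuous
    set A : ℤ → ℝ≥0∞ := fun j => 2 ^ (-(p * β) * j) *
      ∫⁻ y, ENNReal.ofReal |f (c j (cubeIdx n j y)) - f y| ^ p with hA
    have hterm : ∀ j : ℤ, (2 : ℝ≥0∞) ^ (((n : ℝ) - p * β) * j) *
        ∫⁻ y, 2 ^ (-(n : ℝ) * j) * a j y ^ p ≤ A j + 2 ^ (p * β) * A (j + 1) := fun j => by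
      rw [lintegral_const_mul' _ _ (two_rpow_ne_top _), ← mul_assoc, ← two_rpow_add]
      have e1 : ((n : ℝ) - p * β) * j + -(n : ℝ) * j = -(p * β) * j := by ring
      have e2 : (2 : ℝ≥0∞) ^ (p * β) * 2 ^ (-(p * β) * ((j + 1 : ℤ) : ℝ)) = 2 ^ (-(p * β) * j) := by
        rw [← two_rpow_add]
        congr 1
        push_cast
        ring
      simp only [hA]
      rw [e1, ← mul_assoc (2 ^ (p * β)), e2, ← mul_add]
      refine mul_le_mul_right ?_ _
      have hfm := hf.continuous.measurable
      have hm1 : Measurable fun y => ENNReal.ofReal |f (c j (cubeIdx n j y)) - f y| ^ p :=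
        ((hsm j).sub hfm).abs.ennreal_ofReal.pow_const p
      rw [← lintegral_add_left hm1]
      refine lintegral_mono fun y => ?_
      refine (ofReal_abs_sub_rpow_le hp.le hp1 _ (f y) _).trans_eq ?_
      rw [abs_sub_comm (f y)]
    have hsum : ∑' j, A j ≤ S * besovEnergy n 1 ((n : ℝ) + β * p) p f := by
      refine le_trans (ENNReal.tsum_le_tsum fun j => ?_)
        (tsum_scales_setLIntegral_le volume hγ hnpos hwmeas)
      rw [show -((n : ℝ) + β * p) * j = -(p * β) * j + -(n : ℝ) * j by ring, two_rpow_add, mul_assoc]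
      exact mul_le_mul_right (lintegral_sample_sub_le hf.continuous hosc j) _
    refine (ENNReal.tsum_le_tsum hterm).trans ?_
    rw [ENNReal.tsum_add, ENNReal.tsum_mul_left,
      show ∑' j, A (j + 1) = ∑' j, A j from (Equiv.addRight (1 : ℤ)).tsum_eq A]
    calc ∑' j, A j + 2 ^ (p * β) * ∑' j, A j = (1 + 2 ^ (p * β)) * ∑' j, A j := by ring
      _ ≤ _ := by
        rw [mul_assoc]
        gcongr

lemma iterDiff_succ_apply (n k : ℕ) (h : EuclideanSpace ℝ (Fin n))
    (f : EuclideanSpace ℝ (Fin n) → ℝ) (x : EuclideanSpace ℝ (Fin n)) :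
    iterDiff n h (k + 1) f x = iterDiff n h k f (x + h) - iterDiff n h k f x := by
  rw [iterDiff, Function.iterate_succ_apply']
  rfl

lemma lintegral_iterDiff_rpow_le (n k : ℕ) {p : ℝ} (hp : 0 ≤ p) (hp1 : p ≤ 1)
    {f : EuclideanSpace ℝ (Fin n) → ℝ} (hf : Continuous f) (h : EuclideanSpace ℝ (Fin n)) :
    ∫⁻ x, ENNReal.ofReal |iterDiff n h k f x| ^ p ≤ 2 ^ k * ∫⁻ x, ENNReal.ofReal |f x| ^ p := by
  induction k with
  | zero => simp [iterDiff]
  | succ k ih =>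
    have hm : Measurable fun x => iterDiff n h k f x :=
      (continuous_iterDiff n k hf).measurable.comp measurable_prodMk_left
    calc ∫⁻ x, ENNReal.ofReal |iterDiff n h (k + 1) f x| ^ p
        ≤ ∫⁻ x, (ENNReal.ofReal |iterDiff n h k f (x + h)| ^ p +
            ENNReal.ofReal |iterDiff n h k f x| ^ p) := by
          refine lintegral_mono fun x => ?_
          rw [iterDiff_succ_apply]
          simpa using ofReal_abs_sub_rpow_le hp hp1 (iterDiff n h k f (x + h)) 0
            (iterDiff n h k f x)
      _ = 2 * ∫⁻ x, ENNReal.ofReal |iterDiff n h k f x| ^ p := by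
          rw [lintegral_add_right _ (hm.abs.ennreal_ofReal.pow_const p),
            lintegral_add_right_eq_self (fun x => ENNReal.ofReal |iterDiff n h k f x| ^ p) h,
            two_mul]
      _ ≤ 2 * (2 ^ k * ∫⁻ x, ENNReal.ofReal |f x| ^ p) := mul_le_mul_right ih _
      _ = _ := by ring

lemma iterDiff_eq_zero_of_lt_norm (n k : ℕ) {f : EuclideanSpace ℝ (Fin n) → ℝ} {R : ℝ}
    (hR : ∀ x, R < ‖x‖ → f x = 0) {h x : EuclideanSpace ℝ (Fin n)} (hh : ‖h‖ ≤ 1)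
    (hx : R + k < ‖x‖) : iterDiff n h k f x = 0 := by
  induction k generalizing x with
  | zero => exact hR x (by simpa using hx)
  | succ k ih =>
    push_cast at hx
    have h1 : ‖x‖ - ‖h‖ ≤ ‖x + h‖ := by simpa using norm_sub_norm_le x (-h)
    rw [iterDiff_succ_apply, ih (by linarith), ih (by linarith), sub_zero]

lemma exists_lintegral_iterDiff_rpow_le_norm (n k : ℕ) {p : ℝ} (hp : 0 < p)
    {f : EuclideanSpace ℝ (Fin n) → ℝ} (hf : ContDiff ℝ (⊤ : ℕ∞) f) (hfc : HasCompactSupport f) :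
    ∃ C : ℝ≥0∞, C ≠ ∞ ∧ ∀ h, ‖h‖ ≤ 1 → ∫⁻ x, ENNReal.ofReal |iterDiff n h k f x| ^ p ≤
      C * ENNReal.ofReal ‖h‖ ^ (k * p) := by
  obtain ⟨M, hM0, hM⟩ := exists_norm_fwdDiff_iter_le k hf hfc
  obtain ⟨R, hR⟩ := hfc.isCompact.isBounded.subset_closedBall (0 : EuclideanSpace ℝ (Fin n))
  have hR' : ∀ x, R < ‖x‖ → f x = 0 := fun x hx =>
    image_eq_zero_of_notMem_tsupport fun hmem => by
      have := hR hmem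
      rw [mem_closedBall_zero_iff] at this
      linarith
  refine ⟨ENNReal.ofReal M ^ p * volume (closedBall (0 : EuclideanSpace ℝ (Fin n)) (R + k)),
    ENNReal.mul_ne_top (ENNReal.rpow_ne_top_of_nonneg hp.le ENNReal.ofReal_ne_top)
      measure_closedBall_lt_top.ne, fun h hh => ?_⟩
  calc ∫⁻ x, ENNReal.ofReal |iterDiff n h k f x| ^ p
      ≤ ∫⁻ x, (closedBall (0 : EuclideanSpace ℝ (Fin n)) (R + k)).indicator
          (fun _ => ENNReal.ofReal (M * ‖h‖ ^ k) ^ p) x := by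
        refine lintegral_mono fun x => ?_
        by_cases hx : x ∈ closedBall (0 : EuclideanSpace ℝ (Fin n)) (R + k)
        · rw [indicator_of_mem hx]
          exact ENNReal.rpow_le_rpow (ENNReal.ofReal_le_ofReal (hM h x)) hp.le
        · rw [iterDiff_eq_zero_of_lt_norm n k hR' hh (by simpa using hx)]
          simp [hp]
    _ = _ := by
        rw [lintegral_indicator_const measurableSet_closedBall, ENNReal.ofReal_mul hM0,
          ENNReal.mul_rpow_of_nonneg _ _ hp.le, ENNReal.ofReal_pow (norm_nonneg _),
          ← ENNReal.rpow_natCast, ← ENNReal.rpow_mul]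
        ring

lemma setLIntegral_norm_rpow_near_ne_top (n : ℕ) (hn : 1 ≤ n) {r : ℝ} (hr : -(n : ℝ) < r) :
    ∫⁻ h in closedBall (0 : EuclideanSpace ℝ (Fin n)) 1, ENNReal.ofReal ‖h‖ ^ r ≠ ∞ := by
  have : Nonempty (Fin n) := ⟨⟨0, hn⟩⟩
  have hintg : Integrable fun h : EuclideanSpace ℝ (Fin n) =>
      (Ioc (0 : ℝ) 1).indicator (fun y => y ^ r) ‖h‖ := by
    rw [integrable_fun_norm_addHaar volume (f := (Ioc (0 : ℝ) 1).indicator fun y => y ^ r),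
      finrank_euclideanSpace_fin]
    have h1 : IntegrableOn (fun y : ℝ => y ^ (((n : ℝ) - 1) + r)) (Ioc 0 1) := by
      rw [← intervalIntegrable_iff_integrableOn_Ioc_of_le zero_le_one]
      exact intervalIntegral.intervalIntegrable_rpow' (by linarith)
    have h2 : (fun y : ℝ => y ^ (n - 1) • (Ioc (0 : ℝ) 1).indicator (fun y => y ^ r) y) =
        (Ioc (0 : ℝ) 1).indicator (fun y => y ^ (((n : ℝ) - 1) + r)) := by
      funext y
      by_cases hy : y ∈ Ioc (0 : ℝ) 1
      · rw [indicator_of_mem hy, indicator_of_mem hy, Real.rpow_add hy.1, smul_eq_mul,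
          ← Nat.cast_pred hn, Real.rpow_natCast]
      · simp [indicator_of_notMem hy]
    rw [h2]
    exact ((integrable_indicator_iff measurableSet_Ioc).2 h1).integrableOn
  refine ne_top_of_le_ne_top hintg.lintegral_lt_top.ne ?_
  rw [← lintegral_indicator measurableSet_closedBall]
  refine lintegral_mono_ae ?_
  filter_upwards [compl_mem_ae_iff.2 (measure_singleton (0 : EuclideanSpace ℝ (Fin n)))] with h hh
  have hpos : 0 < ‖h‖ := norm_pos_iff.2 hh
  by_cases hm : h ∈ closedBall (0 : EuclideanSpace ℝ (Fin n)) 1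
  · rw [indicator_of_mem hm,
      indicator_of_mem (show ‖h‖ ∈ Ioc (0 : ℝ) 1 from ⟨hpos, by simpa using hm⟩),
      ENNReal.ofReal_rpow_of_pos hpos]
  · simp [indicator_of_notMem hm]

lemma setLIntegral_norm_rpow_far_ne_top (n : ℕ) (hn : 1 ≤ n) {r : ℝ} (hr : r < -(n : ℝ)) :
    ∫⁻ h in (closedBall (0 : EuclideanSpace ℝ (Fin n)) 1)ᶜ, ENNReal.ofReal ‖h‖ ^ r ≠ ∞ := by
  have : Nonempty (Fin n) := ⟨⟨0, hn⟩⟩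
  have hintg : Integrable fun h : EuclideanSpace ℝ (Fin n) =>
      (Ioi (1 : ℝ)).indicator (fun y => y ^ r) ‖h‖ := by
    rw [integrable_fun_norm_addHaar volume (f := (Ioi (1 : ℝ)).indicator fun y => y ^ r),
      finrank_euclideanSpace_fin]
    have h1 : IntegrableOn (fun y : ℝ => y ^ (((n : ℝ) - 1) + r)) (Ioi 1) :=
      integrableOn_Ioi_rpow_of_lt (by linarith) one_pos
    have h2 : (fun y : ℝ => y ^ (n - 1) • (Ioi (1 : ℝ)).indicator (fun y => y ^ r) y) =
        (Ioi (1 : ℝ)).indicator (fun y => y ^ (((n : ℝ) - 1) + r)) := by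
      funext y
      by_cases hy : y ∈ Ioi (1 : ℝ)
      · rw [indicator_of_mem hy, indicator_of_mem hy, Real.rpow_add (one_pos.trans hy),
          smul_eq_mul, ← Nat.cast_pred hn, Real.rpow_natCast]
      · simp [indicator_of_notMem hy]
    rw [h2]
    exact ((integrable_indicator_iff measurableSet_Ioi).2 h1).integrableOn
  refine ne_top_of_le_ne_top hintg.lintegral_lt_top.ne ?_
  rw [← lintegral_indicator measurableSet_closedBall.compl]
  refine lintegral_mono fun h => ?_
  by_cases hm : h ∈ (closedBall (0 : EuclideanSpace ℝ (Fin n)) 1)ᶜ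
  · have hpos : 1 < ‖h‖ := by simpa using hm
    rw [indicator_of_mem hm, indicator_of_mem (mem_Ioi.2 hpos),
      ENNReal.ofReal_rpow_of_pos (one_pos.trans hpos)]
  · simp [indicator_of_notMem hm]

lemma besovEnergy_ne_top (n k : ℕ) (hn : 1 ≤ n) {p β : ℝ} (hp : 0 < p) (hp1 : p ≤ 1) (hβ : 0 < β)
    (hk : β < k) {f : EuclideanSpace ℝ (Fin n) → ℝ} (hf : ContDiff ℝ (⊤ : ℕ∞) f)
    (hfc : HasCompactSupport f) : besovEnergy n k ((n : ℝ) + β * p) p f ≠ ∞ := by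
  obtain ⟨C, hC, hbd⟩ := exists_lintegral_iterDiff_rpow_le_norm n k hp hf hfc
  have hI := lintegral_ofReal_abs_rpow_ne_top n hp hf.continuous hfc
  have hkp : β * p < k * p := by gcongr
  have hβp : 0 < β * p := by positivity
  rw [besovEnergy, ← lintegral_add_compl _ (measurableSet_closedBall (x := 0) (ε := 1))]
  refine ENNReal.add_ne_top.2 ⟨?_, ?_⟩
  · have hnear := setLIntegral_norm_rpow_near_ne_top n hn (r := k * p - ((n : ℝ) + β * p))
      (by linarith)
    refine ne_top_of_le_ne_top (ENNReal.mul_ne_top hC hnear) ?_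
    rw [← lintegral_const_mul' _ _ hC]
    have : Nonempty (Fin n) := ⟨⟨0, hn⟩⟩
    refine lintegral_mono_ae ?_
    filter_upwards [ae_restrict_mem measurableSet_closedBall, ae_restrict_of_ae
      (compl_mem_ae_iff.2 (measure_singleton (0 : EuclideanSpace ℝ (Fin n))))] with h hh h0
    have hpos : 0 < ‖h‖ := norm_pos_iff.2 h0
    rw [sub_eq_add_neg, ENNReal.rpow_add _ _ (by simpa using h0) ENNReal.ofReal_ne_top, ← mul_assoc]
    exact mul_le_mul_left (hbd h (by simpa using hh)) _
  · have hfar := setLIntegral_norm_rpow_far_ne_top n hn (r := -((n : ℝ) + β * p)) (by linarith)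
    have hC' : 2 ^ k * ∫⁻ x, ENNReal.ofReal |f x| ^ p ≠ ∞ :=
      ENNReal.mul_ne_top (ENNReal.pow_ne_top (by simp)) hI
    refine ne_top_of_le_ne_top (ENNReal.mul_ne_top hC' hfar) ?_
    rw [← lintegral_const_mul' _ _ hC']
    exact lintegral_mono fun h =>
      mul_le_mul_left (lintegral_iterDiff_rpow_le n k hp.le hp1 hf.continuous h) _

lemma besovNorm_nonneg (n : ℕ) (β p : ℝ) (f : EuclideanSpace ℝ (Fin n) → ℝ) :
    0 ≤ besovNorm n β p f := by
  unfold besovNorm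
  positivity

/-- On test functions the Besov energy is the `p`-th power of the Besov quasinorm. -/
lemma besovEnergy_eq_ofReal (n : ℕ) (hn : 1 ≤ n) {p β : ℝ} (hp : 0 < p) (hp1 : p ≤ 1) (hβ : 0 < β)
    {f : EuclideanSpace ℝ (Fin n) → ℝ} (hf : ContDiff ℝ (⊤ : ℕ∞) f) (hfc : HasCompactSupport f) :
    besovEnergy n (⌊β⌋₊ + 1) ((n : ℝ) + β * p) p f = ENNReal.ofReal (besovNorm n β p f) ^ p := by
  set k := ⌊β⌋₊ + 1 with hkdef
  have hk : β < k := by exact_mod_cast Nat.lt_floor_add_one β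
  have hfin := besovEnergy_ne_top n k hn hp hp1 hβ hk hf hfc
  set w : EuclideanSpace ℝ (Fin n) → ℝ≥0∞ := fun h =>
    ∫⁻ x, ENNReal.ofReal |iterDiff n h k f x| ^ p with hw
  have hwmeas : Measurable w := measurable_lintegral_iterDiff n k p hf.continuous
  have hwtop : ∀ h, w h ≠ ∞ := fun h => ne_top_of_le_ne_top
    (ENNReal.mul_ne_top (ENNReal.pow_ne_top (by simp))
      (lintegral_ofReal_abs_rpow_ne_top n hp hf.continuous hfc))
    (lintegral_iterDiff_rpow_le n k hp.le hp1 hf.continuous h)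
  have hinner : ∀ h, ∫ x, |iterDiff n h k f x| ^ p = (w h).toReal := fun h => by
    have hm : Measurable fun x => iterDiff n h k f x :=
      (continuous_iterDiff n k hf.continuous).measurable.comp measurable_prodMk_left
    rw [integral_eq_lintegral_of_nonneg_ae
      (Filter.Eventually.of_forall fun x => by positivity)
      (hm.abs.pow_const p).aestronglyMeasurable]
    simp_rw [hw, ENNReal.ofReal_rpow_of_nonneg (abs_nonneg _) hp.le]
  have hnorm : besovNorm n β p f =
      (∫ h, (w h).toReal * ‖h‖ ^ (-((n : ℝ) + β * p))) ^ (1 / p) := by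
    rw [besovNorm, ← hkdef]
    simp_rw [hinner]
  have hg : ∫ h, (w h).toReal * ‖h‖ ^ (-((n : ℝ) + β * p)) =
      (besovEnergy n k ((n : ℝ) + β * p) p f).toReal := by
    have hmeas : Measurable fun h => (w h).toReal * ‖h‖ ^ (-((n : ℝ) + β * p)) :=
      hwmeas.ennreal_toReal.mul (measurable_norm.pow_const _)
    rw [integral_eq_lintegral_of_nonneg_ae (Filter.Eventually.of_forall fun h =>
      mul_nonneg ENNReal.toReal_nonneg (Real.rpow_nonneg (norm_nonneg h) _))
      hmeas.aestronglyMeasurable]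
    congr 1
    have : Nonempty (Fin n) := ⟨⟨0, hn⟩⟩
    refine lintegral_congr_ae ?_
    filter_upwards [compl_mem_ae_iff.2 (measure_singleton (0 : EuclideanSpace ℝ (Fin n)))] with h h0
    rw [ENNReal.ofReal_mul ENNReal.toReal_nonneg, ENNReal.ofReal_toReal (hwtop h),
      ENNReal.ofReal_rpow_of_pos (norm_pos_iff.2 h0)]
  rw [hnorm, hg, ENNReal.ofReal_rpow_of_nonneg (by positivity) hp.le,
    ← Real.rpow_mul ENNReal.toReal_nonneg, one_div_mul_cancel hp.ne', Real.rpow_one,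
    ENNReal.ofReal_toReal hfin]

/-- A measure with the ball-tent growth of order `d` integrates a weighted superposition of
truncated cones of radius `2 ^ m * (κ * 2 ^ j)`. -/
lemma lintegral_tsum_truncCone_le (n : ℕ) (ν : Measure (EuclideanSpace ℝ (Fin n) × ℝ)) [SFinite ν]
    {A : ℝ≥0∞} {a d κ : ℝ} (hd : 0 ≤ d) (hκ : 0 < κ)
    (hν : ∀ y R, 0 < R → ν (truncCone n y R) ≤ A * ENNReal.ofReal R ^ d)
    {W : ℤ → EuclideanSpace ℝ (Fin n) → ℝ≥0∞} (hW : ∀ j, Measurable (W j)) :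
    ∫⁻ z, ∑' j : ℤ, ∑' m : ℕ, ∫⁻ y, W j y * (2 ^ (-a * m) *
        (truncCone n y (2 ^ m * (κ * 2 ^ j))).indicator (fun _ => 1) z) ∂volume ∂ν ≤
      A * ENNReal.ofReal κ ^ d * (∑' m : ℕ, 2 ^ (-(a - d) * m)) *
        ∑' j : ℤ, 2 ^ (d * j) * ∫⁻ y, W j y := by
  have hmeas : ∀ (j : ℤ) (m : ℕ), Measurable
      fun w : (EuclideanSpace ℝ (Fin n) × ℝ) × EuclideanSpace ℝ (Fin n) =>
        W j w.2 * (2 ^ (-a * m) *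
          (truncCone n w.2 (2 ^ m * (κ * 2 ^ j))).indicator (fun _ => (1 : ℝ≥0∞)) w.1) := by
    intro j m
    have h1 : Measurable fun w : (EuclideanSpace ℝ (Fin n) × ℝ) × EuclideanSpace ℝ (Fin n) =>
        (truncCone n w.2 (2 ^ m * (κ * 2 ^ j))).indicator (fun _ => (1 : ℝ≥0∞)) w.1 :=
      (measurable_const (a := (1 : ℝ≥0∞))).indicator
        (measurableSet_truncCone_prod n (2 ^ m * (κ * 2 ^ j)))
    exact ((hW j).comp measurable_snd).mul (h1.const_mul _)
  have hterm : ∀ (j : ℤ) (m : ℕ), ∫⁻ z, ∫⁻ y, W j y * (2 ^ (-a * m) *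
      (truncCone n y (2 ^ m * (κ * 2 ^ j))).indicator (fun _ => 1) z) ∂volume ∂ν ≤
      A * ENNReal.ofReal κ ^ d * (2 ^ (-(a - d) * m) * (2 ^ (d * j) * ∫⁻ y, W j y)) := by
    intro j m
    have hR : (0 : ℝ) < 2 ^ m * (κ * 2 ^ j) := by positivity
    have hscale : ENNReal.ofReal (2 ^ m * (κ * 2 ^ j)) ^ d =
        2 ^ (d * m) * (ENNReal.ofReal κ ^ d * 2 ^ (d * j)) := by
      rw [ENNReal.ofReal_mul (by positivity), ENNReal.ofReal_mul hκ.le, ofReal_two_zpow,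
        ENNReal.mul_rpow_of_nonneg _ _ hd, ENNReal.mul_rpow_of_nonneg _ _ hd,
        ← ENNReal.rpow_mul, ENNReal.ofReal_pow (by norm_num), ← ENNReal.rpow_natCast,
        ← ENNReal.rpow_mul, mul_comm (m : ℝ), mul_comm (j : ℝ), ENNReal.ofReal_ofNat]
    rw [lintegral_lintegral_swap (hmeas j m).aemeasurable]
    calc ∫⁻ y, ∫⁻ z, W j y * (2 ^ (-a * m) *
          (truncCone n y (2 ^ m * (κ * 2 ^ j))).indicator (fun _ => 1) z) ∂ν
        ≤ ∫⁻ y, W j y * (2 ^ (-a * m) *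
            (A * (2 ^ (d * m) * (ENNReal.ofReal κ ^ d * 2 ^ (d * j))))) := by
          refine lintegral_mono fun y => ?_
          have hind : Measurable fun z => (truncCone n y (2 ^ m * (κ * 2 ^ j))).indicator
              (fun _ => (1 : ℝ≥0∞)) z := measurable_const.indicator (measurableSet_truncCone n y _)
          rw [lintegral_const_mul _ (hind.const_mul _), lintegral_const_mul _ hind,
            lintegral_indicator_const (measurableSet_truncCone n y _), one_mul, ← hscale]
          gcongr
          exact hν y _ hR
      _ = _ := by
          rw [lintegral_mul_const _ (hW j), show -(a - d) * (m : ℝ) = -a * m + d * m by ring,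
            two_rpow_add]
          ring
  rw [lintegral_tsum fun j => (Measurable.tsum fun m =>
    (hmeas j m).lintegral_prod_right').aemeasurable, ← ENNReal.tsum_mul_left]
  refine ENNReal.tsum_le_tsum fun j => ?_
  rw [lintegral_tsum fun m => (hmeas j m).lintegral_prod_right'.aemeasurable]
  calc _ ≤ ∑' m : ℕ, A * ENNReal.ofReal κ ^ d *
        (2 ^ (-(a - d) * m) * (2 ^ (d * j) * ∫⁻ y, W j y)) := ENNReal.tsum_le_tsum (hterm j)
    _ = _ := by rw [ENNReal.tsum_mul_left, ENNReal.tsum_mul_right, mul_assoc _ (∑' m : ℕ, _)]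

lemma sigmaFinite_restrict_upperHalf (n : ℕ) {μ : Measure (EuclideanSpace ℝ (Fin n) × ℝ)}
    (hμ : ∀ R, 0 < R → μ (truncCone n 0 R) ≠ ∞) :
    SigmaFinite (μ.restrict {z | 0 < z.2}) := by
  have hU : MeasurableSet {z : EuclideanSpace ℝ (Fin n) × ℝ | 0 < z.2} :=
    measurableSet_lt measurable_const measurable_snd
  refine ⟨⟨{ set := fun N : ℕ => truncCone n 0 (N + 1) ∪ {z | 0 < z.2}ᶜ
             set_mem := fun _ => trivial
             finite := fun N => ?_
             spanning := ?_ }⟩⟩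
  · refine (measure_union_le _ _).trans_lt (ENNReal.add_lt_top.2 ⟨?_, ?_⟩)
    · exact (Measure.restrict_apply_le _ _).trans_lt (hμ _ (by positivity)).lt_top
    · rw [Measure.restrict_apply hU.compl, compl_inter_self, measure_empty]
      exact ENNReal.zero_lt_top
  · refine eq_univ_of_forall fun z => mem_iUnion.2 ?_
    by_cases hz : 0 < z.2
    · obtain ⟨N, hN⟩ := exists_nat_ge (‖z.1 - 0‖ + z.2)
      exact ⟨N, Or.inl ⟨hz, by linarith⟩⟩
    · exact ⟨0, Or.inr hz⟩

/-- The ball-tent condition implies the Lorentz embedding. -/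
lemma condLorentz_of_condBall (n : ℕ) (hn : 1 ≤ n) {s p β q₀ : ℝ} (hs : 0 < s) (hp : 0 < p)
    (hp1 : p ≤ 1) (hβ : 0 < β) (hd : 0 ≤ (n : ℝ) - p * β) (hgap : (n : ℝ) - p * β < n * p)
    (hq₀ : p ≤ q₀) (hdom : HasScaleDomination n (⌊β⌋₊ + 1) s p β)
    {μ : Measure (EuclideanSpace ℝ (Fin n) × ℝ)} (hball : condBall n β p q₀ μ) :
    condLorentz n s β p q₀ μ := by
  obtain ⟨C₀, hC₀, hball⟩ := hball
  obtain ⟨C₁, hC₁, κ, hκ, hdom⟩ := hdom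
  obtain ⟨K, hK, hker⟩ := exists_setLIntegral_pker_rpow_le n hs hp
  have hθ : 0 < p / q₀ := div_pos hp (hp.trans_le hq₀)
  have hθ1 : p / q₀ ≤ 1 := (div_le_one (hp.trans_le hq₀)).2 hq₀
  obtain ⟨C₂, hC₂, hequiv⟩ :=
    exists_measure_rpow_equiv (X := EuclideanSpace ℝ (Fin n) × ℝ) hθ hθ1
  set d := (n : ℝ) - p * β with hddef
  have hcone : ∀ y R, 0 < R →
      μ (truncCone n y R) ^ (p / q₀) ≤ ENNReal.ofReal C₀ * ENNReal.ofReal R ^ d := by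
    intro y R hR
    rw [ENNReal.ofReal_rpow_of_pos hR, ← ENNReal.ofReal_mul hC₀.le]
    exact (ENNReal.rpow_le_rpow (measure_mono (truncCone_subset_tent n y R)) hθ.le).trans
      (hball y R hR)
  have hcone_top : ∀ R, 0 < R → μ (truncCone n 0 R) ≠ ∞ := by
    intro R hR htop
    have h := hcone 0 R hR
    rw [htop, ENNReal.top_rpow_of_pos hθ, top_le_iff] at h
    exact ENNReal.mul_ne_top ENNReal.ofReal_ne_top
      (ENNReal.rpow_ne_top_of_nonneg hd ENNReal.ofReal_ne_top) h
  have : SigmaFinite (μ.restrict {z | 0 < z.2}) := sigmaFinite_restrict_upperHalf n hcone_top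
  have hU : MeasurableSet {z : EuclideanSpace ℝ (Fin n) × ℝ | 0 < z.2} :=
    measurableSet_lt measurable_const measurable_snd
  set S : ℝ≥0∞ := ∑' m : ℕ, 2 ^ (-((n : ℝ) * p - d) * m)
  have hS : S ≠ ∞ := tsum_two_rpow_neg_ne_top (by linarith)
  set B : ℝ≥0∞ := 2 * (K * (C₂ * ENNReal.ofReal C₀ * ENNReal.ofReal κ ^ d * S * C₁)) with hBdef
  have hB : B ≠ ∞ := by
    have : ENNReal.ofReal κ ^ d ≠ ∞ := ENNReal.rpow_ne_top_of_nonneg hd ENNReal.ofReal_ne_top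
    finiteness
  suffices hmain : ∀ f : EuclideanSpace ℝ (Fin n) → ℝ, ContDiff ℝ (⊤ : ℕ∞) f →
      HasCompactSupport f → (∫⁻ l in Ioi (0 : ℝ),
        (μ {z | 0 < z.2 ∧ l < |csExt n s f z.1 z.2|}) ^ (p / q₀) *
          ENNReal.ofReal (p * l ^ (p - 1))) ≤ B * ENNReal.ofReal (besovNorm n β p f) ^ p by
    refine ⟨B.toReal ^ (1 / p) + 1, by positivity, fun f hf hfc => (hmain f hf hfc).trans ?_⟩
    rw [ENNReal.ofReal_mul (by positivity), ENNReal.mul_rpow_of_nonneg _ _ hp.le]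
    gcongr
    calc B = ENNReal.ofReal (B.toReal ^ (1 / p)) ^ p := by
          rw [ENNReal.ofReal_rpow_of_nonneg (by positivity) hp.le,
            ← Real.rpow_mul ENNReal.toReal_nonneg, one_div_mul_cancel hp.ne', Real.rpow_one,
            ENNReal.ofReal_toReal hB]
      _ ≤ _ := ENNReal.rpow_le_rpow (ENNReal.ofReal_le_ofReal (by linarith)) hp.le
  intro f hf hfc
  obtain ⟨W, hW, hWu, hWsum⟩ := hdom f hf hfc
  have hu : Measurable fun z : EuclideanSpace ℝ (Fin n) × ℝ => |csExt n s f z.1 z.2| :=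
    (measurable_csExt n s hf.continuous.measurable).abs
  have hsuper : ∀ l : ℝ, μ.restrict {z | 0 < z.2} {z | l < |csExt n s f z.1 z.2|} =
      μ {z | 0 < z.2 ∧ l < |csExt n s f z.1 z.2|} := fun l => by
    rw [Measure.restrict_apply (measurableSet_lt measurable_const hu), inter_comm]
    rfl
  obtain ⟨ν, hνfin, hνle, hνge⟩ := hequiv (μ.restrict {z | 0 < z.2}) _ hu fun l hl => by
    obtain ⟨R, hR, hsub⟩ := exists_superlevel_subset_truncCone n hn hs hf.continuous hfc hl
    rw [hsuper]
    exact ne_top_of_le_ne_top (hcone_top R hR) (measure_mono hsub)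
  have hνcone : ∀ y R, 0 < R →
      ν (truncCone n y R) ≤ C₂ * ENNReal.ofReal C₀ * ENNReal.ofReal R ^ d := by
    intro y R hR
    rw [mul_assoc]
    exact (hνle _ (measurableSet_truncCone n y R)).trans (mul_le_mul_right
      ((ENNReal.rpow_le_rpow (Measure.restrict_apply_le _ _) hθ.le).trans (hcone y R hR)) _)
  have hνpos : ∀ᵐ z ∂ν, 0 < z.2 := by
    refine le_antisymm ((hνle _ hU.compl).trans ?_) zero_le
    rw [Measure.restrict_apply hU.compl, compl_inter_self, measure_empty,
      ENNReal.zero_rpow_of_pos hθ, mul_zero]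
  have hpoint : ∀ᵐ z ∂ν, ENNReal.ofReal (|csExt n s f z.1 z.2| ^ p) ≤
      K * ∑' j : ℤ, ∑' m : ℕ, ∫⁻ y, W j y * (2 ^ (-((n : ℝ) * p) * m) *
        (truncCone n y (2 ^ m * (κ * 2 ^ j))).indicator (fun _ => 1) z) := by
    filter_upwards [hνpos] with z hz
    rw [← ENNReal.ofReal_rpow_of_nonneg (abs_nonneg _) hp.le]
    refine (hWu z.1 z.2 hz).trans ?_
    rw [← ENNReal.tsum_mul_left]
    refine ENNReal.tsum_le_tsum fun j => ?_
    have hm : ∀ m : ℕ, Measurable fun y => W j y * (2 ^ (-((n : ℝ) * p) * m) *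
        (truncCone n y (2 ^ m * (κ * 2 ^ j))).indicator (fun _ => (1 : ℝ≥0∞)) z) := fun m => by
      have h1 : Measurable fun y =>
          (truncCone n y (2 ^ m * (κ * 2 ^ j))).indicator (fun _ => (1 : ℝ≥0∞)) z :=
        ((measurable_const (a := (1 : ℝ≥0∞))).indicator
          (measurableSet_truncCone_prod n (2 ^ m * (κ * 2 ^ j)))).comp measurable_prodMk_left
      exact (hW j).mul (h1.const_mul _)
    rw [← lintegral_tsum fun m => (hm m).aemeasurable, ← lintegral_const_mul' _ _ hK]
    refine lintegral_mono fun y => ?_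
    rw [ENNReal.tsum_mul_left, mul_left_comm]
    exact mul_le_mul_right (hker z.2 _ z.1 y hz (by positivity)) _
  calc ∫⁻ l in Ioi (0 : ℝ), (μ {z | 0 < z.2 ∧ l < |csExt n s f z.1 z.2|}) ^ (p / q₀) *
        ENNReal.ofReal (p * l ^ (p - 1))
      ≤ ∫⁻ l in Ioi (0 : ℝ), 2 * ENNReal.ofReal p *
          (ν {z | l < |csExt n s f z.1 z.2|} * ENNReal.ofReal (l ^ (p - 1))) := by
        refine setLIntegral_mono' measurableSet_Ioi fun l hl => ?_
        rw [← hsuper, ENNReal.ofReal_mul hp.le]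
        calc _ ≤ 2 * ν {z | l < |csExt n s f z.1 z.2|} *
              (ENNReal.ofReal p * ENNReal.ofReal (l ^ (p - 1))) := mul_le_mul_left (hνge l hl) _
          _ = _ := by ring
    _ = 2 * ∫⁻ z, ENNReal.ofReal (|csExt n s f z.1 z.2| ^ p) ∂ν := by
        rw [lintegral_const_mul' _ _ (by finiteness), mul_assoc,
          lintegral_rpow_eq_lintegral_meas_lt_mul ν
            (Filter.Eventually.of_forall fun _ => abs_nonneg _) hu.aemeasurable hp]
    _ ≤ 2 * (K * (C₂ * ENNReal.ofReal C₀ * ENNReal.ofReal κ ^ d * S *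
          (C₁ * ENNReal.ofReal (besovNorm n β p f) ^ p))) := by
        refine mul_le_mul_right ((lintegral_mono_ae hpoint).trans ?_) _
        rw [lintegral_const_mul' _ _ hK, ← besovEnergy_eq_ofReal n hn hp hp1 hβ hf hfc]
        exact mul_le_mul_right ((lintegral_tsum_truncCone_le n ν hd hκ hνcone hW).trans
          (mul_le_mul_right hWsum _)) _
    _ = B * ENNReal.ofReal (besovNorm n β p f) ^ p := by rw [hBdef]; ring

lemma iterDiff_comp_affine (n k : ℕ) (r : ℝ) (a h : EuclideanSpace ℝ (Fin n))
    (φ : EuclideanSpace ℝ (Fin n) → ℝ) (y : EuclideanSpace ℝ (Fin n)) :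
    iterDiff n h k (fun y => φ (r • (y - a))) y = iterDiff n (r • h) k φ (r • (y - a)) := by
  induction k generalizing y with
  | zero => rfl
  | succ k ih =>
    rw [iterDiff_succ_apply, iterDiff_succ_apply, ih, ih, add_sub_right_comm, smul_add]

/-- Scaling of the Besov quasinorm under translations and dilations. -/
lemma besovNorm_rpow_comp_affine (n : ℕ) {p β r : ℝ} (hp : 0 < p) (hr : 0 < r)
    (a : EuclideanSpace ℝ (Fin n)) (φ : EuclideanSpace ℝ (Fin n) → ℝ) :
    besovNorm n β p (fun y => φ (r⁻¹ • (y - a))) ^ p =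
      r ^ ((n : ℝ) - p * β) * besovNorm n β p φ ^ p := by
  have hpow : ∀ f, besovNorm n β p f ^ p = ∫ h : EuclideanSpace ℝ (Fin n),
      (∫ x, |iterDiff n h (⌊β⌋₊ + 1) f x| ^ p) * ‖h‖ ^ (-((n : ℝ) + β * p)) := fun f => by
    rw [besovNorm, ← Real.rpow_mul (integral_nonneg fun h => mul_nonneg
      (integral_nonneg fun x => by positivity) (by positivity)), one_div_mul_cancel hp.ne',
      Real.rpow_one]
  have hrn : |r ^ Module.finrank ℝ (EuclideanSpace ℝ (Fin n))| = r ^ (n : ℝ) := by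
    rw [finrank_euclideanSpace_fin, abs_of_pos (by positivity), Real.rpow_natCast]
  set I : EuclideanSpace ℝ (Fin n) → ℝ := fun h =>
    ∫ x, |iterDiff n h (⌊β⌋₊ + 1) φ x| ^ p with hI
  have hinner : ∀ h, ∫ x, |iterDiff n h (⌊β⌋₊ + 1) (fun y => φ (r⁻¹ • (y - a))) x| ^ p =
      r ^ (n : ℝ) * I (r⁻¹ • h) := fun h => by
    simp_rw [iterDiff_comp_affine]
    rw [integral_sub_right_eq_self
      (fun x => |iterDiff n (r⁻¹ • h) (⌊β⌋₊ + 1) φ (r⁻¹ • x)| ^ p) a,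
      Measure.integral_comp_inv_smul volume
        (fun x => |iterDiff n (r⁻¹ • h) (⌊β⌋₊ + 1) φ x| ^ p) r, hrn, smul_eq_mul]
  have hnorm : ∀ h : EuclideanSpace ℝ (Fin n), ‖h‖ ^ (-((n : ℝ) + β * p)) =
      r ^ (-((n : ℝ) + β * p)) * ‖r⁻¹ • h‖ ^ (-((n : ℝ) + β * p)) := fun h => by
    rw [← Real.mul_rpow hr.le (norm_nonneg _), norm_smul, norm_inv, Real.norm_of_nonneg hr.le,
      mul_inv_cancel_left₀ hr.ne']
  rw [hpow, hpow]
  calc _ = ∫ h, r ^ (n : ℝ) * r ^ (-((n : ℝ) + β * p)) *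
        (I (r⁻¹ • h) * ‖r⁻¹ • h‖ ^ (-((n : ℝ) + β * p))) := by
        refine integral_congr_ae (Filter.Eventually.of_forall fun h => ?_)
        beta_reduce
        rw [hinner, hnorm]
        ring
    _ = _ := by
        rw [integral_const_mul, Measure.integral_comp_inv_smul volume
          (fun h => I h * ‖h‖ ^ (-((n : ℝ) + β * p))) r, hrn, smul_eq_mul, ← mul_assoc,
          ← Real.rpow_add hr, ← Real.rpow_add hr,
          show (n : ℝ) + -((n : ℝ) + β * p) + n = n - p * β by ring]

/-- The Lorentz embedding implies the Lebesgue embedding. -/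
lemma condLebesgue_of_condLorentz (n : ℕ) {s p β q₀ : ℝ} (hp : 0 < p) (hq₀ : p ≤ q₀)
    {μ : Measure (EuclideanSpace ℝ (Fin n) × ℝ)} (h : condLorentz n s β p q₀ μ) :
    condLebesgue n s β p q₀ μ := by
  obtain ⟨C, hC, h⟩ := h
  have hq : 0 < q₀ := hp.trans_le hq₀
  have hθ : 0 < p / q₀ := div_pos hp hq
  have hθ1 : p / q₀ ≤ 1 := (div_le_one hq).2 hq₀
  refine ⟨(q₀ / p) ^ (1 / q₀) * C, by positivity, fun f hf hfc => ?_⟩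
  set N : ℝ≥0∞ := ENNReal.ofReal (C * besovNorm n β p f) with hN
  set u : EuclideanSpace ℝ (Fin n) × ℝ → ℝ := fun z => |csExt n s f z.1 z.2| with hudef
  set m : ℝ → ℝ≥0∞ := fun l => μ {z | 0 < z.2 ∧ l < |csExt n s f z.1 z.2|} with hm
  have hL : ∫⁻ l in Ioi (0 : ℝ), m l ^ (p / q₀) * ENNReal.ofReal (p * l ^ (p - 1)) ≤ N ^ p :=
    h f hf hfc
  have hu : Measurable u := (measurable_csExt n s hf.continuous.measurable).abs
  have hsuper : ∀ l : ℝ, μ.restrict {z | 0 < z.2} {z | l < u z} = m l := fun l => by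
    rw [Measure.restrict_apply (measurableSet_lt measurable_const hu), inter_comm]
    rfl
  have hweak : ∀ l, 0 < l → m l ^ (p / q₀) * ENNReal.ofReal (l ^ p) ≤ N ^ p := by
    intro l hl
    have hintg : ∫⁻ x in Ioc 0 l, ENNReal.ofReal (p * x ^ (p - 1)) = ENNReal.ofReal (l ^ p) := by
      rw [← ofReal_integral_eq_lintegral_ofReal, ← intervalIntegral.integral_of_le hl.le,
        intervalIntegral.integral_const_mul, integral_rpow (Or.inl (by linarith)), sub_add_cancel,
        Real.zero_rpow hp.ne', sub_zero, mul_div_cancel₀ _ hp.ne']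
      · exact ((intervalIntegrable_iff_integrableOn_Ioc_of_le hl.le).1
          (intervalIntegral.intervalIntegrable_rpow' (by linarith))).const_mul p
      · filter_upwards [ae_restrict_mem measurableSet_Ioc] with x hx
        have := hx.1
        positivity
    rw [← hintg, ← lintegral_const_mul _ (by fun_prop)]
    refine le_trans ?_ hL
    refine le_trans ?_ (lintegral_mono_set (Ioc_subset_Ioi_self : Ioc 0 l ⊆ Ioi 0))
    refine setLIntegral_mono' measurableSet_Ioc fun x hx => ?_
    gcongr
    exact measure_mono fun z hz => ⟨hz.1, hx.2.trans_lt hz.2⟩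
  have hpt : ∀ l, 0 < l → m l * ENNReal.ofReal (l ^ (q₀ - 1)) ≤
      N ^ (q₀ - p) * (m l ^ (p / q₀) * ENNReal.ofReal (l ^ (p - 1))) := by
    intro l hl
    have h1 : (m l ^ (p / q₀) * ENNReal.ofReal (l ^ p)) ^ ((q₀ - p) / p) =
        m l ^ (1 - p / q₀) * ENNReal.ofReal (l ^ (q₀ - p)) := by
      rw [ENNReal.mul_rpow_of_nonneg _ _ (div_nonneg (sub_nonneg.2 hq₀) hp.le), ← ENNReal.rpow_mul,
        ENNReal.ofReal_rpow_of_nonneg (by positivity) (div_nonneg (sub_nonneg.2 hq₀) hp.le),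
        ← Real.rpow_mul hl.le, mul_div_cancel₀ _ hp.ne']
      congr 2
      field_simp
    have h2 : m l ^ (1 - p / q₀) * ENNReal.ofReal (l ^ (q₀ - p)) ≤ N ^ (q₀ - p) := by
      rw [← h1]
      refine (ENNReal.rpow_le_rpow (hweak l hl) (div_nonneg (sub_nonneg.2 hq₀) hp.le)).trans_eq ?_
      rw [← ENNReal.rpow_mul, mul_div_cancel₀ _ hp.ne']
    calc m l * ENNReal.ofReal (l ^ (q₀ - 1))
        = m l ^ (1 - p / q₀) * ENNReal.ofReal (l ^ (q₀ - p)) *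
            (m l ^ (p / q₀) * ENNReal.ofReal (l ^ (p - 1))) := by
          rw [mul_mul_mul_comm, ← ENNReal.rpow_add_of_nonneg _ _ (by linarith) hθ.le,
            sub_add_cancel, ENNReal.rpow_one, ← ENNReal.ofReal_mul (by positivity),
            ← Real.rpow_add hl]
          ring_nf
      _ ≤ _ := mul_le_mul_left h2 _
  have hpp : ∫⁻ l in Ioi (0 : ℝ), m l ^ (p / q₀) * ENNReal.ofReal (p * l ^ (p - 1)) =
      ENNReal.ofReal p * ∫⁻ l in Ioi (0 : ℝ), m l ^ (p / q₀) * ENNReal.ofReal (l ^ (p - 1)) := by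
    rw [← lintegral_const_mul' _ _ ENNReal.ofReal_ne_top]
    refine lintegral_congr fun l => ?_
    rw [ENNReal.ofReal_mul hp.le, mul_left_comm]
  have hNtop : N ^ (q₀ - p) ≠ ∞ :=
    ENNReal.rpow_ne_top_of_nonneg (sub_nonneg.2 hq₀) ENNReal.ofReal_ne_top
  calc ∫⁻ z in {z | 0 < z.2}, ENNReal.ofReal |csExt n s f z.1 z.2| ^ q₀ ∂μ
      = ENNReal.ofReal q₀ * ∫⁻ l in Ioi (0 : ℝ), m l * ENNReal.ofReal (l ^ (q₀ - 1)) := by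
        simp_rw [ENNReal.ofReal_rpow_of_nonneg (abs_nonneg _) hq.le, ← hsuper]
        exact lintegral_rpow_eq_lintegral_meas_lt_mul _
          (Filter.Eventually.of_forall fun _ => abs_nonneg _) hu.aemeasurable hq
    _ ≤ ENNReal.ofReal q₀ * (N ^ (q₀ - p) *
          ∫⁻ l in Ioi (0 : ℝ), m l ^ (p / q₀) * ENNReal.ofReal (l ^ (p - 1))) := by
        rw [← lintegral_const_mul' _ _ hNtop]
        exact mul_le_mul_right (setLIntegral_mono' measurableSet_Ioi hpt) _
    _ = ENNReal.ofReal (q₀ / p) * (N ^ (q₀ - p) *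
          ∫⁻ l in Ioi (0 : ℝ), m l ^ (p / q₀) * ENNReal.ofReal (p * l ^ (p - 1))) := by
        rw [hpp, mul_left_comm (N ^ _), ← mul_assoc (ENNReal.ofReal (q₀ / p)),
          ← ENNReal.ofReal_mul (by positivity), div_mul_cancel₀ _ hp.ne']
    _ ≤ ENNReal.ofReal (q₀ / p) * (N ^ (q₀ - p) * N ^ p) := by gcongr
    _ = _ := by
        rw [← ENNReal.rpow_add_of_nonneg _ _ (sub_nonneg.2 hq₀) hp.le, sub_add_cancel, mul_assoc,
          ENNReal.ofReal_mul (by positivity), ENNReal.mul_rpow_of_nonneg _ _ hq.le,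
          ENNReal.ofReal_rpow_of_nonneg (p := q₀) (x := (q₀ / p) ^ (1 / q₀)) (by positivity) hq.le,
          ← Real.rpow_mul (by positivity), one_div_mul_cancel hq.ne', Real.rpow_one]

/-- The Lebesgue embedding implies the weak-type embedding. -/
lemma condWeak_of_condLebesgue (n : ℕ) {s p β q₀ : ℝ} (hq : 0 < q₀)
    {μ : Measure (EuclideanSpace ℝ (Fin n) × ℝ)} (h : condLebesgue n s β p q₀ μ) :
    condWeak n s β p q₀ μ := by
  obtain ⟨C, hC, h⟩ := h
  refine ⟨C, hC, fun f hf hfc l hl => ?_⟩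
  have hu : Measurable fun z : EuclideanSpace ℝ (Fin n) × ℝ => |csExt n s f z.1 z.2| :=
    (measurable_csExt n s hf.continuous.measurable).abs
  have hsub : μ {z | 0 < z.2 ∧ l < |csExt n s f z.1 z.2|} ≤ μ.restrict {z | 0 < z.2}
      {z | ENNReal.ofReal l ^ q₀ ≤ ENNReal.ofReal |csExt n s f z.1 z.2| ^ q₀} := by
    rw [Measure.restrict_apply (measurableSet_le measurable_const
      (hu.ennreal_ofReal.pow_const q₀))]
    exact measure_mono fun z hz =>
      ⟨ENNReal.rpow_le_rpow (ENNReal.ofReal_le_ofReal hz.2.le) hq.le, hz.1⟩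
  rw [← ENNReal.rpow_le_rpow_iff hq, ENNReal.mul_rpow_of_nonneg _ _ hq.le, ← ENNReal.rpow_mul,
    one_div_mul_cancel hq.ne', ENNReal.rpow_one]
  exact (mul_le_mul_right hsub _).trans ((mul_meas_ge_le_lintegral
    (hu.ennreal_ofReal.pow_const q₀) _).trans (h f hf hfc))

/-- The weak-type embedding implies the ball-tent condition. -/
lemma condBall_of_condWeak (n : ℕ) {s p β q₀ : ℝ} (hs : 0 < s) (hp : 0 < p)
    (hq : 0 < q₀) {μ : Measure (EuclideanSpace ℝ (Fin n) × ℝ)} (h : condWeak n s β p q₀ μ) :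
    condBall n β p q₀ μ := by
  obtain ⟨C, hC, h⟩ := h
  obtain ⟨c, hc, htent⟩ := exists_le_csExt_on_tent n hs
  let φ : ContDiffBump (0 : EuclideanSpace ℝ (Fin n)) := ⟨1, 2, one_pos, one_lt_two⟩
  set D : ℝ := (2 * C / c) ^ p * besovNorm n β p φ ^ p with hD
  have hφ0 : 0 ≤ besovNorm n β p φ := besovNorm_nonneg n β p φ
  refine ⟨D + 1, by positivity, fun x r hr => ?_⟩
  set f : EuclideanSpace ℝ (Fin n) → ℝ := fun y => φ (r⁻¹ • (y - x)) with hf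
  have hfs : ContDiff ℝ (⊤ : ℕ∞) f := φ.contDiff.comp (by fun_prop)
  have hfc : HasCompactSupport f := by
    have he : Topology.IsClosedEmbedding fun y : EuclideanSpace ℝ (Fin n) => r⁻¹ • (y - x) :=
      ((Homeomorph.subRight x).trans
        (Homeomorph.smulOfNeZero r⁻¹ (inv_ne_zero hr.ne'))).isClosedEmbedding
    exact φ.hasCompactSupport.comp_isClosedEmbedding he
  have hf1 : ∀ y ∈ ball x r, 1 ≤ f y := fun y hy => by
    refine (φ.one_of_mem_closedBall ?_).ge
    rw [mem_closedBall_zero_iff, norm_smul, norm_inv, Real.norm_of_nonneg hr.le,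
      ← dist_eq_norm, inv_mul_le_iff₀ hr]
    simpa [φ] using (mem_ball.1 hy).le
  have hsub : tent n (ball x r) ⊆ {z | 0 < z.2 ∧ c / 2 < |csExt n s f z.1 z.2|} := fun z hz =>
    ⟨hz.1, ((half_lt_self hc).trans_le
      (htent f _ hfs.continuous hfc (fun _ => φ.nonneg) hf1 z hz)).trans_le (le_abs_self _)⟩
  have hweak : ENNReal.ofReal (c / 2) * μ (tent n (ball x r)) ^ (1 / q₀) ≤
      ENNReal.ofReal (C * besovNorm n β p f) := by
    exact (mul_le_mul_right (ENNReal.rpow_le_rpow (measure_mono hsub) (by positivity)) _).trans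
      (h f hfs hfc _ (half_pos hc))
  have hμ : μ (tent n (ball x r)) ^ (1 / q₀) ≤
      ENNReal.ofReal (2 * C / c * besovNorm n β p f) := by
    have : ENNReal.ofReal (2 * C / c * besovNorm n β p f) =
        ENNReal.ofReal (C * besovNorm n β p f) / ENNReal.ofReal (c / 2) := by
      rw [← ENNReal.ofReal_div_of_pos (by positivity)]
      congr 1
      field_simp
    rw [this, ENNReal.le_div_iff_mul_le (by simp [hc]) (by simp), mul_comm]
    exact hweak
  have hf0 : 0 ≤ besovNorm n β p f := besovNorm_nonneg n β p f
  calc μ (tent n (ball x r)) ^ (p / q₀) = (μ (tent n (ball x r)) ^ (1 / q₀)) ^ p := by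
        rw [← ENNReal.rpow_mul, one_div_mul_eq_div]
    _ ≤ ENNReal.ofReal (2 * C / c * besovNorm n β p f) ^ p := ENNReal.rpow_le_rpow hμ hp.le
    _ = ENNReal.ofReal (D * r ^ ((n : ℝ) - p * β)) := by
        rw [ENNReal.ofReal_rpow_of_nonneg (by positivity) hp.le,
          Real.mul_rpow (by positivity) hf0, hf, besovNorm_rpow_comp_affine n hp hr, hD]
        ring_nf
    _ ≤ _ := by
        gcongr
        linarith

/-- for `p = 1, β ∈ (0,n)` or `p ∈ (n/(n+β),1), β ∈ (0,1)`, and `q₀ ∈ [p,∞)`,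
the conditions (i) Lorentz-norm embedding, (ii) Lebesgue-norm embedding, (iii) weak-type
embedding, and (iv) the ball-tent growth condition, are all equivalent. -/
theorem carleson_embedding_besov (n : ℕ) (hn : 1 ≤ n) (s : ℝ) (hs : s ∈ Set.Ioo (0:ℝ) 2)
    (p β q₀ : ℝ)
    (hpβ : (p = 1 ∧ 0 < β ∧ β < n) ∨ ((n:ℝ)/((n:ℝ) + β) < p ∧ p < 1 ∧ 0 < β ∧ β < 1))
    (hq₀ : p ≤ q₀)
    (μ : Measure (EuclideanSpace ℝ (Fin n) × ℝ)) :
    (condLorentz n s β p q₀ μ ↔ condLebesgue n s β p q₀ μ) ∧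
    (condLebesgue n s β p q₀ μ ↔ condWeak n s β p q₀ μ) ∧
    (condWeak n s β p q₀ μ ↔ condBall n β p q₀ μ) := by
  have hcases : 0 < p ∧ p ≤ 1 ∧ 0 < β ∧ 0 ≤ (n : ℝ) - p * β ∧ (n : ℝ) - p * β < n * p ∧
      HasScaleDomination n (⌊β⌋₊ + 1) s p β := by
    have hn' : (1 : ℝ) ≤ n := by exact_mod_cast hn
    rcases hpβ with ⟨rfl, hβ, hβn⟩ | ⟨hnp, hp1, hβ, hβ1⟩
    · exact ⟨one_pos, le_rfl, hβ, by linarith, by linarith,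
        hasScaleDomination_one n _ hn (Nat.le_add_left _ _) hs.1 hβ⟩
    · have hp : 0 < p := lt_of_le_of_lt (by positivity) hnp
      have hgap : (n : ℝ) < p * (n + β) := (div_lt_iff₀ (by positivity)).1 hnp
      refine ⟨hp, hp1.le, hβ, by nlinarith, by linarith, ?_⟩
      rw [Nat.floor_eq_zero.2 hβ1]
      exact hasScaleDomination_of_le_one n hn hs.1 hp hp1.le hβ
  obtain ⟨hp, hp1, hβ, hd, hgap, hdom⟩ := hcases
  have hq : 0 < q₀ := hp.trans_le hq₀
  have hLebesgue := condLebesgue_of_condLorentz (s := s) (β := β) (μ := μ) n hp hq₀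
  have hWeak := condWeak_of_condLebesgue (s := s) (β := β) (p := p) (μ := μ) n hq
  have hBall := condBall_of_condWeak (β := β) (μ := μ) n hs.1 hp hq
  have hLorentz := condLorentz_of_condBall (μ := μ) n hn hs.1 hp hp1 hβ hd hgap hq₀ hdom
  exact ⟨⟨hLebesgue, hLorentz ∘ hBall ∘ hWeak⟩, ⟨hWeak, hLebesgue ∘ hLorentz ∘ hBall⟩,
    ⟨hBall, hWeak ∘ hLebesgue ∘ hLorentz⟩⟩

end
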